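/- Let (G, L) be an instance of MLCM-P on a path G = (V, E), with no line of L lying entirely on a single edge, and let (G', L') be the instance of MLCM obtained by adding to each edge e = (u,v) of the path a red cross: vertices u_1, v_1 above the path, u_2, v_2 below the path, edges (u,u_1), (u,u_2), (v,v_1), (v,v_2), together with ℓ = |L|² red lines from u_1 to v_2 and ℓ red lines from u_2 to v_1. For each edge e, let ℓ_e^t and ℓ_e^m be the numbers of lines of L on e that have, respectively do not have, a terminal at an endpoint of e, and set K := |E|·ℓ² + Σ_{e∈E} (ℓ_e^t + 2ℓ_e^m)·ℓ. Then (G, L) has an MLCM-P solution with at most k crossings if and only if (G', L') has an MLCM solution with at most k + K crossings. -/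

import Mathlib

/-!
Core model for metro-line crossing minimization (MLCM).

An embedded graph is a symmetric loopless graph together with, for each
vertex, a list of its neighbours in clockwise order (the embedding).
A line is a simple path in the graph.  A line layout assigns to each
ordered pair `(u, v)` forming an edge the clockwise order `ord u v` in
which the lines through `{u, v}` meet the port of `u`.
-/

structure EmbeddedGraph (V : Type) where
  adj : V → V → Prop
  symm : ∀ {u v}, adj u v → adj v u
  loopless : ∀ v, ¬ adj v v
  rot : V → List V
  rot_mem : ∀ u v, v ∈ rot u ↔ adj u v
  rot_nodup : ∀ u, (rot u).Nodup

/-- `p` is a simple path (with at least one edge) in `G`. -/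
def EmbeddedGraph.IsPath {V : Type} (G : EmbeddedGraph V) (p : List V) : Prop :=
  p.Nodup ∧ 2 ≤ p.length ∧ p.Chain' G.adj

/-- An instance of MLCM: an embedded graph together with a set of lines
(indexed by `ι`), each a simple path. -/
structure MLCMInstance (V ι : Type) where
  G : EmbeddedGraph V
  line : ι → List V
  line_path : ∀ i, G.IsPath (line i)

namespace MLCMInstance

variable {V ι : Type}

/-- Line `i` passes through the edge `{u, v}`. -/
def usesEdge (M : MLCMInstance V ι) (i : ι) (u v : V) : Prop :=
  [u, v] <:+: M.line i ∨ [v, u] <:+: M.line i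

/-- `u` is a terminal (an endpoint) of line `i`. -/
def Terminal (M : MLCMInstance V ι) (i : ι) (u : V) : Prop :=
  (M.line i).head? = some u ∨ (M.line i).getLast? = some u

/-- A line layout: for each ordered pair `(u, v)`, the clockwise order
(at the port of `u`) of the lines through the edge `{u, v}`. -/
structure Layout (M : MLCMInstance V ι) where
  ord : V → V → List ι
  nodup : ∀ u v, (ord u v).Nodup
  mem_iff : ∀ u v i, i ∈ ord u v ↔ M.usesEdge i u v

variable {M : MLCMInstance V ι}

/-- Lines `i` and `j` have an edge crossing on the edge `{u, v}`:
they appear in the same relative order in both port orders. -/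
def EdgeCross (lay : M.Layout) (i j : ι) (u v : V) : Prop :=
  i ≠ j ∧ List.Sublist [i, j] (lay.ord u v) ∧ List.Sublist [i, j] (lay.ord v u)

/-- The cyclic concatenation of the port orders at `u`, following the
clockwise order of the edges incident to `u`. -/
def cyclicAt (lay : M.Layout) (u : V) : List ι :=
  (M.G.rot u).flatMap fun w => lay.ord u w

/-- Lines `i` and `j` have a vertex crossing at `u`: they alternate
`… i … j … i … j …` in the cyclic concatenation of the port orders. -/
def VertexCross (lay : M.Layout) (i j : ι) (u : V) : Prop :=
  i ≠ j ∧ ∃ n, List.Sublist [i, j, i, j] ((cyclicAt lay u).rotate n)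

/-- Lines `i` and `j` cross in the layout. -/
def Crosses (lay : M.Layout) (i j : ι) : Prop :=
  (∃ u v, EdgeCross lay i j u v ∨ EdgeCross lay j i u v) ∨
  (∃ u, VertexCross lay i j u ∨ VertexCross lay j i u)

/-- The pair of lines `i, j` has an unavoidable crossing: the lines
cross in every line layout. -/
def Unavoidable (M : MLCMInstance V ι) (i j : ι) : Prop :=
  ∀ lay : M.Layout, Crosses lay i j

/-- A vertex crossing of `i, j` at `u` is unavoidable: it occurs in
every line layout. -/
def UnavoidableVC (M : MLCMInstance V ι) (i j : ι) (u : V) : Prop :=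
  ∀ lay : M.Layout, VertexCross lay i j u ∨ VertexCross lay j i u

/-- A layout is feasible when it contains no avoidable vertex crossings. -/
def Feasible (lay : M.Layout) : Prop :=
  ∀ i j u, VertexCross lay i j u → M.UnavoidableVC i j u

/-- A layout is crossing-free when no two lines cross in it. -/
def CrossingFree (lay : M.Layout) : Prop :=
  ∀ i j, i ≠ j → ¬ Crosses lay i j

/-- The periphery condition: at every port the lines terminating at that
vertex occupy the outermost positions of the port order. -/
def Periphery (lay : M.Layout) : Prop :=
  ∀ u v, ∃ s₁ s₂ s₃ : List ι, lay.ord u v = s₁ ++ s₂ ++ s₃ ∧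
    (∀ i ∈ s₁, M.Terminal i u) ∧ (∀ i ∈ s₂, ¬ M.Terminal i u) ∧
    (∀ i ∈ s₃, M.Terminal i u)

/-- `P` occurs as a (contiguous) subpath of line `i` (in either direction). -/
def InfixOf (M : MLCMInstance V ι) (i : ι) (P : List V) : Prop :=
  P <:+: M.line i ∨ P.reverse <:+: M.line i

/-- `P` is a common subpath (with at least one edge) of lines `i` and `j`. -/
def CommonSubpath (M : MLCMInstance V ι) (i j : ι) (P : List V) : Prop :=
  2 ≤ P.length ∧ M.InfixOf i P ∧ M.InfixOf j P

/-- `P` is the (maximal) common subpath of lines `i` and `j`. -/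
def MaxCommonSubpath (M : MLCMInstance V ι) (i j : ι) (P : List V) : Prop :=
  M.CommonSubpath i j P ∧ ∀ Q, M.CommonSubpath i j Q → Q.length ≤ P.length

/-- No line is a subpath of another line. -/
def ProperLines (M : MLCMInstance V ι) : Prop :=
  ∀ i j, i ≠ j → ¬ M.InfixOf j (M.line i)

/-- Relative to the edge directed from `u` to `v`: line `i` is above
line `j` in every crossing-free solution. -/
def MustAbove (M : MLCMInstance V ι) (i j : ι) (u v : V) : Prop :=
  ∀ lay : M.Layout, Feasible lay → CrossingFree lay → List.Sublist [i, j] (lay.ord u v)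

/-- `i, j` is an overlapping pair with common subpath `P` from `u` to `v`:
`i` has its terminal at `u`, and `j` has its terminal at `v`. -/
def OverlappingPair (M : MLCMInstance V ι) (i j : ι) (P : List V) (u v : V) : Prop :=
  i ≠ j ∧ M.MaxCommonSubpath i j P ∧ P.head? = some u ∧ P.getLast? = some v ∧
    M.Terminal i u ∧ M.Terminal j v ∧ ¬ M.Terminal i v ∧ ¬ M.Terminal j u

/-- `l` is a separator of the overlapping pair `i, j` with common subpath `P`:
on `P`, in every crossing-free solution, `l` lies between `i` and `j`. -/
def Separator (M : MLCMInstance V ι) (i j : ι) (P : List V) (l : ι) : Prop :=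
  l ≠ i ∧ l ≠ j ∧ ∃ u v, [u, v] <:+: P ∧
    ((M.MustAbove i l u v ∧ M.MustAbove l j u v) ∨
     (M.MustAbove j l u v ∧ M.MustAbove l i u v))

end MLCMInstance

namespace MLCMInstance

variable {n : ℕ} {ι : Type}

/-- The number of (edge) crossings of a layout: the number of pairs
(pair of lines, edge) such that the two lines cross on that edge.
(Unavoidable vertex crossings are not counted.) -/
noncomputable def crossingCount {V : Type} (M : MLCMInstance V ι) (lay : M.Layout) : ℕ :=
  Nat.card {q : (ι × ι) × Sym2 V //
    ∃ u v : V, q.2 = s(u, v) ∧ EdgeCross lay q.1.1 q.1.2 u v}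

/-- `ℓ_e^t`: the number of lines on the path edge `e = (e, e+1)` that have a
terminal at an endpoint of `e`. -/
noncomputable def termLineCount (M : MLCMInstance (Fin n) ι) (e : Fin (n - 1)) : ℕ :=
  Nat.card {i : ι //
    M.usesEdge i ⟨e.val, by have := e.isLt; omega⟩ ⟨e.val + 1, by have := e.isLt; omega⟩ ∧
    (M.Terminal i ⟨e.val, by have := e.isLt; omega⟩ ∨
     M.Terminal i ⟨e.val + 1, by have := e.isLt; omega⟩)}

/-- `ℓ_e^m`: the number of lines on the path edge `e = (e, e+1)` that have no
terminal at an endpoint of `e`. -/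
noncomputable def midLineCount (M : MLCMInstance (Fin n) ι) (e : Fin (n - 1)) : ℕ :=
  Nat.card {i : ι //
    M.usesEdge i ⟨e.val, by have := e.isLt; omega⟩ ⟨e.val + 1, by have := e.isLt; omega⟩ ∧
    ¬ (M.Terminal i ⟨e.val, by have := e.isLt; omega⟩ ∨
       M.Terminal i ⟨e.val + 1, by have := e.isLt; omega⟩)}

/-- `K := |E| ⬝ ℓ² + ∑ₑ (ℓ_e^t + 2 ℓ_e^m) ⬝ ℓ`, with `ℓ = |L|²`. -/
noncomputable def Kconst (M : MLCMInstance (Fin n) ι) : ℕ :=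
  (n - 1) * (Nat.card ι ^ 2) ^ 2 +
    ∑ e : Fin (n - 1), (M.termLineCount e + 2 * M.midLineCount e) * Nat.card ι ^ 2

end MLCMInstance

namespace List

variable {α β : Type*}

theorem pair_sublist_append_iff {x y : α} {A B : List α} :
    [x, y] <+ A ++ B ↔ [x, y] <+ A ∨ [x, y] <+ B ∨ (x ∈ A ∧ y ∈ B) := by
  constructor
  · intro h
    obtain ⟨a, b, hab, ha, hb⟩ := sublist_append_iff.1 h
    match a, hab with
    | [], hab => simp_all
    | [p], hab => simp at hab; obtain ⟨rfl, rfl⟩ := hab; simp_all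
    | [p, q], hab => simp at hab; obtain ⟨rfl, rfl, rfl⟩ := hab; simp_all
  · rintro (h | h | ⟨h, h'⟩)
    · exact h.trans (sublist_append_left _ _)
    · exact h.trans (sublist_append_right _ _)
    · exact (singleton_sublist.2 h).append (singleton_sublist.2 h')

theorem not_sublist_of_duplicate {x : α} {p A : List α} (hA : A.Nodup) (hp : [x, x] <+ p) :
    ¬ p <+ A := by
  intro h
  have := hA.sublist (hp.trans h)
  simp at this

theorem alternating_three_sublist_append_iff {x y : α} {A B : List α} (hA : A.Nodup) :
    [x, y, x] <+ A ++ B ↔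
      [x, y, x] <+ B ∨ (x ∈ A ∧ [y, x] <+ B) ∨ ([x, y] <+ A ∧ x ∈ B) := by
  constructor
  · intro h
    obtain ⟨a, b, hab, ha, hb⟩ := sublist_append_iff.1 h
    match a, hab with
    | [], hab => simp_all
    | [p], hab => simp at hab; obtain ⟨rfl, rfl⟩ := hab; simp_all
    | [p, q], hab => simp at hab; obtain ⟨rfl, rfl, rfl⟩ := hab; simp_all
    | [p, q, r], hab =>
      simp at hab; obtain ⟨rfl, rfl, rfl, rfl⟩ := hab
      exact absurd ha (not_sublist_of_duplicate (x := x) hA (by simp))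
  · rintro (h | ⟨h, h'⟩ | ⟨h, h'⟩)
    · exact h.trans (sublist_append_right _ _)
    · exact (singleton_sublist.2 h).append h'
    · exact h.append (singleton_sublist.2 h')

theorem alternating_four_sublist_append_iff {x y : α} {A B : List α} (hA : A.Nodup) :
    [x, y, x, y] <+ A ++ B ↔
      [x, y, x, y] <+ B ∨ (x ∈ A ∧ [y, x, y] <+ B) ∨ ([x, y] <+ A ∧ [x, y] <+ B) := by
  constructor
  · intro h
    obtain ⟨a, b, hab, ha, hb⟩ := sublist_append_iff.1 h
    match a, hab with
    | [], hab => simp_all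
    | [p], hab => simp at hab; obtain ⟨rfl, rfl⟩ := hab; simp_all
    | [p, q], hab => simp at hab; obtain ⟨rfl, rfl, rfl⟩ := hab; simp_all
    | p :: q :: r :: s, hab =>
      simp at hab; obtain ⟨rfl, rfl, rfl, hab⟩ := hab
      exact absurd ha (not_sublist_of_duplicate (x := x) hA (by simp))
  · rintro (h | ⟨h, h'⟩ | ⟨h, h'⟩)
    · exact h.trans (sublist_append_right _ _)
    · exact (singleton_sublist.2 h).append h'
    · exact h.append h'

theorem alternating_of_sublist_rotate {x y : α} {l : List α} {k : ℕ}
    (h : [x, y, x, y] <+ l.rotate k) : [x, y, x, y] <+ l ∨ [y, x, y, x] <+ l := by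
  rw [rotate_eq_drop_append_take_mod] at h
  obtain ⟨a, b, hab, ha, hb⟩ := sublist_append_iff.1 h
  have key : b ++ a <+ l := by
    have := hb.append ha
    rwa [take_append_drop] at this
  match a, hab with
  | [], hab => simp at hab; subst hab; exact Or.inl (by simpa using key)
  | [p], hab => simp at hab; obtain ⟨rfl, rfl⟩ := hab; exact Or.inr key
  | [p, q], hab => simp at hab; obtain ⟨rfl, rfl, rfl⟩ := hab; exact Or.inl key
  | [p, q, r], hab => simp at hab; obtain ⟨rfl, rfl, rfl, rfl⟩ := hab; exact Or.inr key
  | p :: q :: r :: s :: t, hab =>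
    simp at hab; obtain ⟨rfl, rfl, rfl, rfl, rfl, rfl⟩ := hab; exact Or.inl key

theorem pair_sublist_total {l : List α} {x y : α} (hx : x ∈ l) (hy : y ∈ l) (hxy : x ≠ y) :
    [x, y] <+ l ∨ [y, x] <+ l := by
  induction l with
  | nil => simp at hx
  | cons a l ih =>
    rcases mem_cons.1 hx with rfl | hx'
    · left
      exact cons_sublist_cons.2 (singleton_sublist.2 ((mem_cons.1 hy).resolve_left hxy.symm))
    · rcases mem_cons.1 hy with rfl | hy'
      · right
        exact cons_sublist_cons.2 (singleton_sublist.2 hx')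
      · exact (ih hx' hy').imp (fun h => h.cons _) (fun h => h.cons _)

theorem Nodup.pair_sublist_asymm {l : List α} (hl : l.Nodup) {x y : α} (h : [x, y] <+ l) :
    ¬ [y, x] <+ l := by
  induction l with
  | nil => simp at h
  | cons a l ih =>
    have hl' := nodup_cons.1 hl
    intro h'
    rw [cons_sublist_cons'] at h h'
    have m1 : ∀ p q : α, [p, q] <+ l → p ∈ l ∧ q ∈ l := fun p q hpq =>
      ⟨hpq.subset (by simp), hpq.subset (by simp)⟩
    rcases h with h | ⟨rfl, h⟩ <;> rcases h' with h' | ⟨rfl, h'⟩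
    · exact ih hl'.2 h h'
    · exact hl'.1 (m1 _ _ h).2
    · exact hl'.1 (m1 _ _ h').2
    · exact hl'.1 (singleton_sublist.1 h)

theorem Nodup.pair_sublist_ne {l : List α} (hl : l.Nodup) {x y : α} (h : [x, y] <+ l) :
    x ≠ y := by
  rintro rfl
  exact hl.pair_sublist_asymm h h

theorem Nodup.pair_sublist_trans {l : List α} (hl : l.Nodup) {x y z : α} (h : [x, y] <+ l)
    (h' : [y, z] <+ l) : [x, z] <+ l := by
  induction l with
  | nil => simp at h
  | cons a l ih =>
    have hl' := nodup_cons.1 hl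
    rw [cons_sublist_cons'] at h h' ⊢
    have m1 : ∀ p q : α, [p, q] <+ l → p ∈ l ∧ q ∈ l := fun p q hpq =>
      ⟨hpq.subset (by simp), hpq.subset (by simp)⟩
    rcases h with h | ⟨rfl, h⟩ <;> rcases h' with h' | ⟨rfl, h'⟩
    · exact Or.inl (ih hl'.2 h h')
    · exact absurd (m1 _ _ h).2 hl'.1
    · exact Or.inr ⟨rfl, singleton_sublist.2 (m1 _ _ h').2⟩
    · exact absurd (singleton_sublist.1 h) hl'.1

theorem mem_of_pair_sublist {l : List α} {x y : α} (h : [x, y] <+ l) : x ∈ l ∧ y ∈ l :=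
  ⟨h.subset (by simp), h.subset (by simp)⟩

/-- A list in which no entry satisfying `P` lies between two entries violating `P` has all
entries satisfying `P` at its two ends. -/
theorem exists_periphery_split (P : α → Prop) {l : List α}
    (h : ∀ a b c, [a, b, c] <+ l → ¬ P a → P b → P c) :
    ∃ s₁ s₂ s₃ : List α, l = s₁ ++ s₂ ++ s₃ ∧
      (∀ i ∈ s₁, P i) ∧ (∀ i ∈ s₂, ¬ P i) ∧ (∀ i ∈ s₃, P i) := by
  have tail_split : ∀ l : List α, (∀ b c, [b, c] <+ l → P b → P c) →
      ∃ s₂ s₃ : List α, l = s₂ ++ s₃ ∧ (∀ i ∈ s₂, ¬ P i) ∧ (∀ i ∈ s₃, P i) := by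
    intro l
    induction l with
    | nil => exact fun _ => ⟨[], [], by simp⟩
    | cons a l ih =>
      intro h
      by_cases ha : P a
      · refine ⟨[], a :: l, rfl, by simp, ?_⟩
        intro i hi
        rcases mem_cons.1 hi with rfl | hi
        · exact ha
        · exact h a i (cons_sublist_cons.2 (singleton_sublist.2 hi)) ha
      · obtain ⟨s₂, s₃, rfl, h2, h3⟩ := ih fun b c hbc => h b c (hbc.cons _)
        refine ⟨a :: s₂, s₃, rfl, ?_, h3⟩
        simpa [ha] using h2
  induction l with
  | nil => exact ⟨[], [], [], by simp⟩
  | cons a l ih =>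
    by_cases ha : P a
    · obtain ⟨s₁, s₂, s₃, rfl, h1, h2, h3⟩ := ih fun x y z hxyz => h x y z (hxyz.cons _)
      exact ⟨a :: s₁, s₂, s₃, rfl, by simpa [ha] using h1, h2, h3⟩
    · obtain ⟨s₂, s₃, hs, h2, h3⟩ :=
        tail_split (a :: l) fun b c hbc hb => by
          rcases cons_sublist_cons'.1 hbc with hbc | ⟨rfl, hbc⟩
          · exact h a b c (cons_sublist_cons.2 hbc) ha hb
          · exact absurd hb ha
      exact ⟨[], s₂, s₃, hs, by simp, h2, h3⟩

theorem exists_list_of_key [Finite α] {γ : Type*} [LinearOrder γ] (P : α → Prop) (f : α → γ)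
    (hf : ∀ x y, P x → P y → f x = f y → x = y) :
    ∃ l : List α, l.Nodup ∧ (∀ x, x ∈ l ↔ P x) ∧
      ∀ x y, [x, y] <+ l ↔ P x ∧ P y ∧ f x < f y := by
  classical
  have := Fintype.ofFinite α
  let l := (Finset.univ.filter P).toList.insertionSort (fun x y => f x ≤ f y)
  have hperm : l.Perm (Finset.univ.filter P).toList := perm_insertionSort _ _
  have hnd : l.Nodup := hperm.nodup_iff.2 (Finset.nodup_toList _)
  have hmem : ∀ x, x ∈ l ↔ P x := fun x => by simp [hperm.mem_iff]
  have hsort : l.Pairwise (fun x y => f x ≤ f y) := by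
    have : Std.Total (fun x y : α => f x ≤ f y) := ⟨fun x y => le_total _ _⟩
    have : IsTrans α (fun x y : α => f x ≤ f y) := ⟨fun x y z => le_trans⟩
    exact pairwise_insertionSort _ _
  have fwd : ∀ x y, [x, y] <+ l → P x ∧ P y ∧ f x < f y := by
    intro x y h
    have hx := (hmem x).1 (mem_of_pair_sublist h).1
    have hy := (hmem y).1 (mem_of_pair_sublist h).2
    refine ⟨hx, hy, lt_of_le_of_ne (pairwise_iff_forall_sublist.1 hsort h) fun he => ?_⟩
    exact hnd.pair_sublist_ne h (hf x y hx hy he)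
  refine ⟨l, hnd, hmem, fun x y => ⟨fwd x y, fun ⟨hx, hy, hlt⟩ => ?_⟩⟩
  rcases pair_sublist_total ((hmem x).2 hx) ((hmem y).2 hy) (by rintro rfl; exact lt_irrefl _ hlt)
    with h | h
  · exact h
  · exact absurd (fwd _ _ h).2.2 hlt.not_gt

theorem pair_infix_iff {l : List α} {x y : α} :
    [x, y] <:+: l ↔ ∃ k : ℕ, l[k]? = some x ∧ l[k + 1]? = some y := by
  constructor
  · rintro ⟨s, t, rfl⟩
    exact ⟨s.length, by simp, by simp⟩
  · rintro ⟨k, hx, hy⟩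
    obtain ⟨h1, rfl⟩ := getElem?_eq_some_iff.1 hx
    obtain ⟨h2, rfl⟩ := getElem?_eq_some_iff.1 hy
    refine ⟨l.take k, l.drop (k + 2), ?_⟩
    rw [append_assoc]
    conv_rhs => rw [← take_append_drop k l]
    rw [drop_eq_getElem_cons h1, drop_eq_getElem_cons h2]
    rfl

theorem pair_infix_map_iff {f : α → β} (hf : Function.Injective f) {l : List α} {x y : α} :
    [f x, f y] <:+: l.map f ↔ [x, y] <:+: l := by
  simp [pair_infix_iff, hf.eq_iff]

theorem pair_infix_cons_cons_iff {l : List α} {a b x y : α} :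
    [x, y] <:+: a :: b :: l ↔ (x = a ∧ y = b) ∨ [x, y] <:+: b :: l := by
  rw [infix_cons_iff]
  simp [cons_prefix_cons]

theorem not_pair_infix_singleton {a x y : α} : ¬ [x, y] <:+: [a] := fun h => by
  simpa using h.length_le

theorem eq_range'_of_isChain_of_step_up : ∀ (t : List ℕ) (a : ℕ), (a :: (a + 1) :: t).Nodup →
    ((a + 1) :: t).IsChain (fun x y => x + 1 = y ∨ y + 1 = x) →
    a :: (a + 1) :: t = range' a (t.length + 2)
  | [], a, _, _ => by simp [range'_succ]
  | c :: t, a, hnd, hch => by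
    have hc : c = a + 1 + 1 := by
      have h1 := (isChain_cons_cons.1 hch).1
      simp at hnd
      omega
    subst hc
    rw [eq_range'_of_isChain_of_step_up t (a + 1) (nodup_cons.1 hnd).2 (isChain_cons_cons.1 hch).2]
    simp [range'_succ]

theorem eq_range'_reverse_of_isChain_of_step_down : ∀ (t : List ℕ) (a : ℕ),
    ((a + 1) :: a :: t).Nodup →
    (a :: t).IsChain (fun x y => x + 1 = y ∨ y + 1 = x) →
    ∃ lo, lo + t.length = a ∧ (a + 1) :: a :: t = (range' lo (t.length + 2)).reverse
  | [], a, _, _ => ⟨a, by simp, by simp [range'_succ]⟩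
  | c :: t, a, hnd, hch => by
    have hc : a = c + 1 := by
      have h1 := (isChain_cons_cons.1 hch).1
      simp at hnd
      omega
    subst hc
    obtain ⟨lo, hlo, h⟩ := eq_range'_reverse_of_isChain_of_step_down t c (nodup_cons.1 hnd).2
      (isChain_cons_cons.1 hch).2
    refine ⟨lo, by simp; omega, ?_⟩
    rw [h, length_cons, range'_1_concat (n := t.length + 2)]
    simp only [reverse_append, reverse_singleton, singleton_append, cons.injEq, and_true]
    omega

theorem exists_eq_range'_of_isChain {l : List ℕ} (hnd : l.Nodup) (hlen : 2 ≤ l.length)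
    (hch : l.IsChain (fun x y => x + 1 = y ∨ y + 1 = x)) :
    ∃ lo, l = range' lo l.length ∨ l = (range' lo l.length).reverse := by
  match l, hlen with
  | a :: b :: t, _ =>
    rcases (isChain_cons_cons.1 hch).1 with h | h
    · subst h
      exact ⟨a, Or.inl (eq_range'_of_isChain_of_step_up t a hnd (isChain_cons_cons.1 hch).2)⟩
    · subst h
      obtain ⟨lo, -, h⟩ := eq_range'_reverse_of_isChain_of_step_down t b hnd
        (isChain_cons_cons.1 hch).2
      exact ⟨lo, Or.inr h⟩

end List

namespace MLCMInstance

section General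

variable {V ι : Type} {M : MLCMInstance V ι}

theorem usesEdge_comm {i : ι} {u v : V} : M.usesEdge i u v ↔ M.usesEdge i v u := Or.comm

theorem EdgeCross.symm {lay : M.Layout} {i j : ι} {u v : V} (h : EdgeCross lay i j u v) :
    EdgeCross lay i j v u := ⟨h.1, h.2.2, h.2.1⟩

theorem EdgeCross.usesEdge {lay : M.Layout} {i j : ι} {u v : V} (h : EdgeCross lay i j u v) :
    M.usesEdge i u v := (lay.mem_iff _ _ _).1 (List.mem_of_pair_sublist h.2.1).1

theorem edgeCross_iff {lay : M.Layout} {i j : ι} {u v : V} :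
    EdgeCross lay i j u v ↔ [i, j].Sublist (lay.ord u v) ∧ [i, j].Sublist (lay.ord v u) :=
  ⟨fun h => h.2, fun h => ⟨(lay.nodup _ _).pair_sublist_ne h.1, h⟩⟩

/-- No two lines alternate at any vertex. -/
def NoAlternation (lay : M.Layout) : Prop :=
  ∀ u i j, i ≠ j → ¬ [i, j, i, j].Sublist (cyclicAt lay u)

theorem NoAlternation.not_vertexCross {lay : M.Layout} (h : NoAlternation lay) (i j : ι) (u : V) :
    ¬ VertexCross lay i j u := by
  rintro ⟨hij, k, hk⟩
  rcases List.alternating_of_sublist_rotate hk with hk | hk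
  · exact h u i j hij hk
  · exact h u j i hij.symm hk

theorem NoAlternation.feasible {lay : M.Layout} (h : NoAlternation lay) : Feasible lay :=
  fun i j u hij => absurd hij (h.not_vertexCross i j u)

theorem Feasible.noAlternation {lay lay₀ : M.Layout} (h : Feasible lay)
    (h₀ : NoAlternation lay₀) : NoAlternation lay := by
  intro u i j hij hs
  rcases h i j u ⟨hij, 0, by simpa using hs⟩ lay₀ with h' | h' <;>
    exact h₀.not_vertexCross _ _ _ h'

theorem exists_layout_of_key [Finite ι] {γ : Type*} [LinearOrder γ] (M : MLCMInstance V ι)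
    (key : V → V → ι → γ)
    (hkey : ∀ u v i j, M.usesEdge i u v → M.usesEdge j u v → key u v i = key u v j → i = j) :
    ∃ lay : M.Layout, ∀ u v i j, [i, j].Sublist (lay.ord u v) ↔
      M.usesEdge i u v ∧ M.usesEdge j u v ∧ key u v i < key u v j := by
  choose l hnd hmem hl using fun u v =>
    List.exists_list_of_key (fun i => M.usesEdge i u v) (key u v) (hkey u v)
  exact ⟨⟨l, hnd, hmem⟩, hl⟩

theorem crossingCount_le_of_injOn [Finite ι] [Finite V] (lay : M.Layout)
    (h : ∀ i j u v u' v', EdgeCross lay i j u v → EdgeCross lay i j u' v' → s(u, v) = s(u', v')) :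
    M.crossingCount lay ≤ Nat.card ι ^ 2 := by
  rw [sq, ← Nat.card_prod]
  refine Nat.card_le_card_of_injective
    (fun q : {q : (ι × ι) × Sym2 V //
      ∃ u v : V, q.2 = s(u, v) ∧ EdgeCross lay q.1.1 q.1.2 u v} => q.1.1) ?_
  rintro ⟨⟨⟨i, j⟩, e⟩, u, v, he, hc⟩ ⟨⟨⟨i', j'⟩, e'⟩, u', v', he', hc'⟩ hq
  simp only [Prod.mk.injEq] at hq he he' hc hc'
  obtain ⟨rfl, rfl⟩ := hq
  subst he he'
  simp [h _ _ _ _ _ _ hc hc']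

variable {E : Type} [Fintype E] {f g : E → V}

theorem sum_card_edgeCross_le [Finite ι] [Finite V] (lay : M.Layout)
    (hfg : ∀ e e', s(f e, g e) = s(f e', g e') → e = e') :
    ∑ e, Nat.card {q : ι × ι // EdgeCross lay q.1 q.2 (f e) (g e)} ≤ M.crossingCount lay := by
  rw [← Nat.card_sigma]
  refine Nat.card_le_card_of_injective
    (fun x : (Σ e, {q : ι × ι // EdgeCross lay q.1 q.2 (f e) (g e)}) =>
      (⟨(x.2.1, s(f x.1, g x.1)), f x.1, g x.1, rfl, x.2.2⟩ :
      {q : (ι × ι) × Sym2 V // ∃ u v : V, q.2 = s(u, v) ∧ EdgeCross lay q.1.1 q.1.2 u v})) ?_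
  rintro ⟨e, q, hq⟩ ⟨e', q', hq'⟩ h
  simp only [Subtype.mk.injEq, Prod.mk.injEq] at h
  obtain ⟨rfl, h⟩ := h
  obtain rfl := hfg _ _ h
  rfl

theorem crossingCount_eq_sum [Finite ι] [Finite V] (lay : M.Layout)
    (hfg : ∀ e e', s(f e, g e) = s(f e', g e') → e = e')
    (hall : ∀ i j u v, EdgeCross lay i j u v → ∃ e, s(u, v) = s(f e, g e)) :
    M.crossingCount lay =
      ∑ e, Nat.card {q : ι × ι // EdgeCross lay q.1 q.2 (f e) (g e)} := by
  refine le_antisymm ?_ (sum_card_edgeCross_le lay hfg)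
  rw [← Nat.card_sigma]
  refine Nat.card_le_card_of_surjective
    (fun x : (Σ e, {q : ι × ι // EdgeCross lay q.1 q.2 (f e) (g e)}) =>
      (⟨(x.2.1, s(f x.1, g x.1)), f x.1, g x.1, rfl, x.2.2⟩ :
      {q : (ι × ι) × Sym2 V // ∃ u v : V, q.2 = s(u, v) ∧ EdgeCross lay q.1.1 q.1.2 u v})) ?_
  rintro ⟨⟨q, s⟩, u, v, hs, hq⟩
  obtain ⟨e, he⟩ := hall _ _ _ _ hq
  have hs : s = s(u, v) := hs
  subst hs
  have hq' : EdgeCross lay q.1 q.2 (f e) (g e) := by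
    rcases Sym2.eq_iff.1 he with ⟨rfl, rfl⟩ | ⟨rfl, rfl⟩
    · exact hq
    · exact hq.symm
  exact ⟨⟨e, q, hq'⟩, by simp [he]⟩

end General

section Path

variable {n : ℕ} {ι : Type}

/-- Every line of `M` runs along the path from vertex `lo i` to vertex `hi i`, over at least
two edges. -/
structure IsSpan (M : MLCMInstance (Fin n) ι) (lo hi : ι → ℕ) : Prop where
  add_two_le : ∀ i, lo i + 2 ≤ hi i
  lt : ∀ i, hi i < n
  uses_iff : ∀ i (a b : Fin n), M.usesEdge i a b ↔
    (a.val + 1 = b.val ∧ lo i ≤ a.val ∧ b.val ≤ hi i) ∨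
    (b.val + 1 = a.val ∧ lo i ≤ b.val ∧ a.val ≤ hi i)
  terminal_iff : ∀ i (a : Fin n), M.Terminal i a ↔ a.val = lo i ∨ a.val = hi i

theorem exists_isSpan (M : MLCMInstance (Fin n) ι)
    (hMadj : ∀ a b : Fin n, M.G.adj a b ↔ (a.val + 1 = b.val ∨ b.val + 1 = a.val))
    (hlong : ∀ i : ι, 3 ≤ (M.line i).length) :
    ∃ lo hi : ι → ℕ, M.IsSpan lo hi := by
  have hinj : Function.Injective (fun a : Fin n => a.val) := Fin.val_injective
  have key : ∀ i, ∃ lo, (M.line i).map (fun a => a.val) = List.range' lo (M.line i).length ∨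
      (M.line i).map (fun a => a.val) = (List.range' lo (M.line i).length).reverse := by
    intro i
    obtain ⟨hnd, hlen, hch⟩ := M.line_path i
    have := List.exists_eq_range'_of_isChain (l := (M.line i).map (fun a => a.val))
      (hnd.map hinj) (by simpa using hlen)
      ((List.isChain_map _).2 (hch.imp fun a b h => (hMadj a b).1 h))
    simpa using this
  choose lo hlo using key
  have hmem : ∀ (i : ι) x, lo i ≤ x → x < lo i + (M.line i).length → x < n := by
    intro i x h1 h2
    have : x ∈ (M.line i).map (fun a => a.val) := by
      rcases hlo i with h | h <;> rw [h] <;> simp [List.mem_range'_1, h1, h2]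
    obtain ⟨a, -, rfl⟩ := List.mem_map.1 this
    exact a.2
  have hpair : ∀ l k x y, [x, y] <:+: List.range' l k ↔ x + 1 = y ∧ l ≤ x ∧ y < l + k := by
    intro l k x y
    rw [List.pair_infix_iff]
    constructor
    · rintro ⟨m, h1, h2⟩
      obtain ⟨h1', h1⟩ := List.getElem?_eq_some_iff.1 h1
      obtain ⟨h2', h2⟩ := List.getElem?_eq_some_iff.1 h2
      simp at h1 h2 h1' h2'
      omega
    · rintro ⟨rfl, h1, h2⟩
      refine ⟨x - l, ?_, ?_⟩ <;> rw [List.getElem?_range' (by omega)] <;> simp <;> omega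
  refine ⟨lo, fun i => lo i + (M.line i).length - 1, ?_, ?_, ?_, ?_⟩
  · intro i
    have := hlong i
    omega
  · intro i
    have := hlong i
    exact hmem i _ (by omega) (by omega)
  · intro i a b
    have := hlong i
    unfold usesEdge
    rw [← List.pair_infix_map_iff hinj, ← List.pair_infix_map_iff (l := M.line i) hinj (x := b)]
    rcases hlo i with h | h
    · rw [h, hpair, hpair]
      omega
    · have hrev : ∀ x y, [x, y] <:+: (List.range' (lo i) (M.line i).length).reverse ↔
          [y, x] <:+: List.range' (lo i) (M.line i).length := fun x y => by
        rw [← List.reverse_infix, List.reverse_reverse]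
        rfl
      rw [h, hrev, hrev, hpair, hpair]
      omega
  · intro i a
    have := hlong i
    have hne : M.line i ≠ [] := by
      intro h
      simp [h] at this
    unfold Terminal
    have e1 : (M.line i).head? = some a ↔
        ((M.line i).map (fun a => a.val)).head? = some a.val := by
      rw [List.head?_map, Option.map_eq_some_iff]
      simp [Fin.val_inj]
    have e2 : (M.line i).getLast? = some a ↔
        ((M.line i).map (fun a => a.val)).getLast? = some a.val := by
      rw [List.getLast?_map, Option.map_eq_some_iff]
      simp [Fin.val_inj]
    rw [e1, e2]
    rcases hlo i with h | h
    · rw [h]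
      simp [List.head?_range', List.getLast?_range', hne]
      omega
    · rw [h]
      simp [List.head?_range', List.getLast?_range', hne]
      omega

end Path

end MLCMInstance

namespace MLCMInstance

section Slots

variable {V ι E : Type} {M : MLCMInstance V ι}

/-- The port order at `u` towards `f e` for the edge `e` stored in `o`, and the empty list if
there is no such edge. -/
def slot (lay : M.Layout) (u : V) (o : Option E) (f : E → V) : List ι :=
  o.toList.flatMap fun e => lay.ord u (f e)

theorem nodup_slot (lay : M.Layout) (u : V) (o : Option E) (f : E → V) :
    (slot lay u o f).Nodup := by
  cases o <;> simp [slot, lay.nodup]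

theorem mem_slot {lay : M.Layout} {u : V} {o : Option E} {f : E → V} {i : ι} :
    i ∈ slot lay u o f ↔ ∃ e, o = some e ∧ M.usesEdge i u (f e) := by
  cases o <;> simp [slot, lay.mem_iff]

theorem pair_sublist_slot {lay : M.Layout} {u : V} {o : Option E} {f : E → V} {i j : ι} :
    [i, j].Sublist (slot lay u o f) ↔ ∃ e, o = some e ∧ [i, j].Sublist (lay.ord u (f e)) := by
  cases o <;> simp [slot]

end Slots

section Path

variable {n : ℕ} {ι : Type}

/-- The left endpoint of the path edge `e`. -/
def lv (e : Fin (n - 1)) : Fin n := ⟨e.val, by have := e.isLt; omega⟩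

/-- The right endpoint of the path edge `e`. -/
def rv (e : Fin (n - 1)) : Fin n := ⟨e.val + 1, by have := e.isLt; omega⟩

@[simp] theorem val_lv (e : Fin (n - 1)) : (lv e).val = e.val := rfl

@[simp] theorem val_rv (e : Fin (n - 1)) : (rv e).val = e.val + 1 := rfl

/-- The path edge to the right of `u`, if there is one. -/
def edgeRight (u : Fin n) : Option (Fin (n - 1)) :=
  if h : u.val < n - 1 then some ⟨u.val, h⟩ else none

/-- The path edge to the left of `u`, if there is one. -/
def edgeLeft (u : Fin n) : Option (Fin (n - 1)) :=
  if h : 0 < u.val then some ⟨u.val - 1, by have := u.isLt; omega⟩ else none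

theorem edgeRight_eq_some {u : Fin n} {e : Fin (n - 1)} :
    edgeRight u = some e ↔ e.val = u.val := by
  have := e.isLt
  unfold edgeRight
  split_ifs with h
  · simp [Fin.ext_iff, eq_comm]
  · simp only [false_iff]
    omega

theorem edgeLeft_eq_some {u : Fin n} {e : Fin (n - 1)} :
    edgeLeft u = some e ↔ e.val + 1 = u.val := by
  unfold edgeLeft
  split_ifs with h
  · simp only [Option.some.injEq, Fin.ext_iff]
    omega
  · simp only [false_iff]
    omega

/-- The clockwise order at each path vertex is right neighbour, then left neighbour. -/
def IsHorizontalPath (M : MLCMInstance (Fin n) ι) : Prop :=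
  ∀ u, M.G.rot u = (edgeRight u).toList.map rv ++ (edgeLeft u).toList.map lv

theorem IsHorizontalPath.cyclicAt_eq {M : MLCMInstance (Fin n) ι} (hM : M.IsHorizontalPath)
    (lay : M.Layout) (u : Fin n) :
    cyclicAt lay u = slot lay u (edgeRight u) rv ++ slot lay u (edgeLeft u) lv := by
  simp [cyclicAt, hM u, slot, List.flatMap_append, List.flatMap_map]

theorem IsHorizontalPath.noAlternation_iff {M : MLCMInstance (Fin n) ι}
    (hM : M.IsHorizontalPath) (lay : M.Layout) :
    NoAlternation lay ↔ ∀ e e' : Fin (n - 1), lv e = rv e' → ∀ i j, i ≠ j →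
      ¬ ([i, j].Sublist (lay.ord (lv e) (rv e)) ∧ [i, j].Sublist (lay.ord (lv e) (lv e'))) := by
  have key : ∀ u i j, [i, j, i, j].Sublist (cyclicAt lay u) ↔
      [i, j].Sublist (slot lay u (edgeRight u) rv) ∧
        [i, j].Sublist (slot lay u (edgeLeft u) lv) := by
    intro u i j
    have hr : ¬ [i, j, i, j].Sublist (slot lay u (edgeLeft u) lv) :=
      List.not_sublist_of_duplicate (x := i) (nodup_slot _ _ _ _) (by simp)
    have hr' : ¬ [j, i, j].Sublist (slot lay u (edgeLeft u) lv) :=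
      List.not_sublist_of_duplicate (x := j) (nodup_slot _ _ _ _) (by simp)
    rw [hM.cyclicAt_eq, List.alternating_four_sublist_append_iff (nodup_slot _ _ _ _)]
    simp [hr, hr']
  constructor
  · intro h e e' he i j hij hs
    refine h (lv e) i j hij ((key _ _ _).2 ⟨?_, ?_⟩)
    · exact pair_sublist_slot.2 ⟨e, edgeRight_eq_some.2 rfl, hs.1⟩
    · exact pair_sublist_slot.2 ⟨e', edgeLeft_eq_some.2 (by simp [he]), hs.2⟩
  · intro h u i j hij hs
    obtain ⟨h1, h2⟩ := (key _ _ _).1 hs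
    obtain ⟨e, he, h1⟩ := pair_sublist_slot.1 h1
    obtain ⟨e', he', h2⟩ := pair_sublist_slot.1 h2
    have hu : u = lv e := Fin.ext (edgeRight_eq_some.1 he).symm
    subst hu
    exact h e e' (Fin.ext (edgeLeft_eq_some.1 he').symm) i j hij ⟨h1, h2⟩

theorem IsSpan.exists_edge {M : MLCMInstance (Fin n) ι} {lo hi : ι → ℕ} (hM : M.IsSpan lo hi)
    {i : ι} {u v : Fin n} (h : M.usesEdge i u v) :
    ∃ e : Fin (n - 1), (u = lv e ∧ v = rv e) ∨ (u = rv e ∧ v = lv e) := by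
  have := u.isLt
  have := v.isLt
  rcases (hM.uses_iff i u v).1 h with h | h
  · exact ⟨⟨u.val, by omega⟩, Or.inl ⟨rfl, Fin.ext h.1.symm⟩⟩
  · exact ⟨⟨v.val, by omega⟩, Or.inr ⟨Fin.ext h.1.symm, rfl⟩⟩

theorem IsSpan.uses_lv_rv {M : MLCMInstance (Fin n) ι} {lo hi : ι → ℕ} (hM : M.IsSpan lo hi)
    {i : ι} {e : Fin (n - 1)} : M.usesEdge i (lv e) (rv e) ↔ lo i ≤ e.val ∧ e.val < hi i := by
  rw [hM.uses_iff]
  simp only [val_lv, val_rv, true_and]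
  omega

theorem IsSpan.uses_rv_lv {M : MLCMInstance (Fin n) ι} {lo hi : ι → ℕ} (hM : M.IsSpan lo hi)
    {i : ι} {e : Fin (n - 1)} : M.usesEdge i (rv e) (lv e) ↔ lo i ≤ e.val ∧ e.val < hi i := by
  rw [usesEdge_comm, hM.uses_lv_rv]

theorem sym2_lv_rv_injective {e e' : Fin (n - 1)} (h : s(lv e, rv e) = s(lv e', rv e')) :
    e = e' := by
  simp only [Sym2.eq_iff, Fin.ext_iff, val_lv, val_rv] at h
  ext
  omega

/-- The solution in which every terminating line lies on top of the port it terminates at. -/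
theorem IsSpan.exists_few_crossings [Fintype ι] {M : MLCMInstance (Fin n) ι} {lo hi : ι → ℕ}
    (hM : M.IsSpan lo hi) (hrot : M.IsHorizontalPath) :
    ∃ lay : M.Layout, NoAlternation lay ∧ Periphery lay ∧
      M.crossingCount lay ≤ Nat.card ι ^ 2 := by
  let idx : ι → ℤ := fun i => ((Fintype.equivFin ι i).val : ℤ)
  have hidx : ∀ i j, idx i = idx j → i = j := by
    intro i j h
    simpa [idx, Fin.val_inj] using h
  obtain ⟨lay, hlay⟩ := exists_layout_of_key M (γ := ℤ ×ₗ ℤ ×ₗ ℤ)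
    (fun a b i => if a.val < b.val then toLex (0, toLex (-(lo i : ℤ), idx i))
      else toLex (if hi i = a.val then 1 else 0, toLex ((lo i : ℤ), -idx i)))
    (by
      intro u v i j _ _ h
      apply hidx
      split_ifs at h <;> simp at h <;> omega)
  have hL : ∀ e i j, [i, j].Sublist (lay.ord (lv e) (rv e)) →
      (lo i ≤ e.val ∧ e.val < hi i) ∧ (lo j ≤ e.val ∧ e.val < hi j) ∧
      (lo j < lo i ∨ lo i = lo j ∧ idx i < idx j) := by
    intro e i j h
    rw [hlay, hM.uses_lv_rv, hM.uses_lv_rv] at h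
    refine ⟨h.1, h.2.1, ?_⟩
    have := h.2.2
    simp [Prod.Lex.toLex_lt_toLex] at this
    omega
  have hR : ∀ e i j, [i, j].Sublist (lay.ord (rv e) (lv e)) →
      (lo i ≤ e.val ∧ e.val < hi i) ∧ (lo j ≤ e.val ∧ e.val < hi j) ∧
      ((hi i ≠ e.val + 1 ∧ hi j = e.val + 1) ∨
        (hi i = e.val + 1 ↔ hi j = e.val + 1) ∧
        (lo i < lo j ∨ lo i = lo j ∧ idx j < idx i)) := by
    intro e i j h
    rw [hlay, hM.uses_rv_lv, hM.uses_rv_lv] at h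
    refine ⟨h.1, h.2.1, ?_⟩
    have := h.2.2
    simp [Prod.Lex.toLex_lt_toLex] at this
    split_ifs at this <;> omega
  refine ⟨lay, ?_, ?_, ?_⟩
  · rw [hrot.noAlternation_iff]
    rintro e e' he i j - ⟨h1, h2⟩
    have he' : e.val = e'.val + 1 := congrArg Fin.val he
    rw [he] at h2
    have h1 := hL _ _ _ h1
    have h2 := hR _ _ _ h2
    omega
  · intro u v
    refine List.exists_periphery_split (fun i => M.Terminal i u) ?_
    intro a b c habc ha hb
    have hab : [a, b].Sublist (lay.ord u v) := List.Sublist.trans (by simp) habc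
    have hbc : [b, c].Sublist (lay.ord u v) := List.Sublist.trans (by simp) habc
    obtain ⟨e, ⟨rfl, rfl⟩ | ⟨rfl, rfl⟩⟩ := hM.exists_edge ((hlay _ _ _ _).1 hab).1
    · have hab := hL _ _ _ hab
      have hbc := hL _ _ _ hbc
      simp only [hM.terminal_iff, val_lv] at *
      omega
    · have hab := hR _ _ _ hab
      have hbc := hR _ _ _ hbc
      simp only [hM.terminal_iff, val_rv] at *
      omega
  · refine crossingCount_le_of_injOn lay ?_
    have key : ∀ i j u v, EdgeCross lay i j u v →
        ∃ e : Fin (n - 1), s(u, v) = s(lv e, rv e) ∧ e.val + 1 = hi j := by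
      intro i j u v h
      obtain ⟨e, he⟩ := hM.exists_edge h.usesEdge
      have h' : EdgeCross lay i j (lv e) (rv e) := by
        rcases he with ⟨rfl, rfl⟩ | ⟨rfl, rfl⟩
        · exact h
        · exact h.symm
      refine ⟨e, Sym2.eq_iff.2 he, ?_⟩
      have h1 := hL _ _ _ h'.2.1
      have h2 := hR _ _ _ h'.2.2
      omega
    intro i j u v u' v' h h'
    obtain ⟨e, he, h1⟩ := key _ _ _ _ h
    obtain ⟨e', he', h1'⟩ := key _ _ _ _ h'
    obtain rfl : e = e' := Fin.ext (by omega)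
    rw [he, he']

end Path

end MLCMInstance

namespace MLCMInstance

section RedCross

variable {n ℓ : ℕ} {ι : Type}

/-- `M'` arises from the path instance `M` by adding a red cross with `ℓ` lines of each of the two
kinds to every edge. -/
structure IsRedCross (M : MLCMInstance (Fin n) ι)
    (M' : MLCMInstance (Fin n ⊕ (Fin (n - 1) × Fin 4)) (ι ⊕ (Fin (n - 1) × Fin ℓ × Bool))) :
    Prop where
  uses_old : ∀ i a b, M'.usesEdge (Sum.inl i) (Sum.inl a) (Sum.inl b) ↔ M.usesEdge i a b
  not_uses_old : ∀ i x q, ¬ M'.usesEdge (Sum.inl i) x (Sum.inr q)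
  uses_red : ∀ e c b x y, M'.usesEdge (Sum.inr (e, c, b)) x y ↔
    s(x, y) = s(Sum.inl (lv e), Sum.inl (rv e)) ∨
    s(x, y) = s(Sum.inl (lv e), Sum.inr (e, if b then 0 else 1)) ∨
    s(x, y) = s(Sum.inl (rv e), Sum.inr (e, if b then 3 else 2))
  rot_inl : ∀ u, M'.G.rot (Sum.inl u) =
    (edgeLeft u).toList.map (fun e => Sum.inr (e, 2)) ++
    ((edgeRight u).toList.map (fun e => Sum.inr (e, 0)) ++
    ((edgeRight u).toList.map (fun e => Sum.inl (rv e)) ++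
    ((edgeRight u).toList.map (fun e => Sum.inr (e, 1)) ++
    ((edgeLeft u).toList.map (fun e => Sum.inr (e, 3)) ++
    (edgeLeft u).toList.map (fun e => Sum.inl (lv e))))))
  rot_inr : ∀ q, ∃ w, M'.G.rot (Sum.inr q) = [w]

variable {M : MLCMInstance (Fin n) ι}
  {M' : MLCMInstance (Fin n ⊕ (Fin (n - 1) × Fin 4)) (ι ⊕ (Fin (n - 1) × Fin ℓ × Bool))}

theorem usesEdge_of_line_eq_four {V ι : Type} {M : MLCMInstance V ι} {i : ι} {a b c d : V}
    (h : M.line i = [a, b, c, d]) (x y : V) :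
    M.usesEdge i x y ↔ s(x, y) = s(b, c) ∨ s(x, y) = s(b, a) ∨ s(x, y) = s(c, d) := by
  simp only [usesEdge, h, List.pair_infix_cons_cons_iff, List.not_pair_infix_singleton,
    Sym2.eq_iff]
  tauto

theorem isRedCross_of_lines (hn : 2 ≤ n)
    (hold : ∀ i : ι, M'.line (Sum.inl i) = (M.line i).map Sum.inl)
    (hredT : ∀ (e : Fin (n - 1)) (c : Fin ℓ), M'.line (Sum.inr (e, c, true)) =
        [Sum.inr (e, 0), Sum.inl (lv e), Sum.inl (rv e), Sum.inr (e, 3)])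
    (hredF : ∀ (e : Fin (n - 1)) (c : Fin ℓ), M'.line (Sum.inr (e, c, false)) =
        [Sum.inr (e, 1), Sum.inl (lv e), Sum.inl (rv e), Sum.inr (e, 2)])
    (hrot'0 : ∀ (h0 : 0 < n) (h1 : 1 < n) (h0' : 0 < n - 1),
      M'.G.rot (Sum.inl ⟨0, h0⟩) =
        [Sum.inr (⟨0, h0'⟩, 0), Sum.inl ⟨1, h1⟩, Sum.inr (⟨0, h0'⟩, 1)])
    (hrot'Last : ∀ (h1 : n - 1 < n) (h2 : n - 2 < n) (h2' : n - 2 < n - 1),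
      M'.G.rot (Sum.inl ⟨n - 1, h1⟩) =
        [Sum.inr (⟨n - 2, h2'⟩, 2), Sum.inr (⟨n - 2, h2'⟩, 3), Sum.inl ⟨n - 2, h2⟩])
    (hrot'Int : ∀ (u : ℕ) (_ : 0 < u) (h : u < n - 1) (h0 : u < n) (h1 : u + 1 < n)
      (h2 : u - 1 < n) (h2' : u - 1 < n - 1),
      M'.G.rot (Sum.inl ⟨u, h0⟩) =
        [Sum.inr (⟨u - 1, h2'⟩, 2), Sum.inr (⟨u, h⟩, 0), Sum.inl ⟨u + 1, h1⟩,
         Sum.inr (⟨u, h⟩, 1), Sum.inr (⟨u - 1, h2'⟩, 3), Sum.inl ⟨u - 1, h2⟩])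
    (hrot'Leaf : ∀ (e : Fin (n - 1)) (p : Fin 4), ∃ w, M'.G.rot (Sum.inr (e, p)) = [w]) :
    IsRedCross M M' where
  uses_old i a b := by
    simp only [usesEdge, hold, List.pair_infix_map_iff Sum.inl_injective]
  not_uses_old i x q h := by
    have hq : Sum.inr q ∈ M'.line (Sum.inl i) := by
      rcases h with h | h <;> exact h.subset (by simp)
    rw [hold] at hq
    simp at hq
  uses_red e c b x y := by
    cases b
    · rw [usesEdge_of_line_eq_four (hredF e c)]
      simp
    · rw [usesEdge_of_line_eq_four (hredT e c)]
      simp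
  rot_inl u := by
    obtain ⟨u, hu⟩ := u
    rcases Nat.eq_zero_or_pos u with rfl | h0
    · rw [hrot'0 _ (by omega) (by omega)]
      have h1 : (0 : ℕ) < n - 1 := by omega
      simp [edgeLeft, edgeRight, h1, rv]
    · rcases lt_or_ge u (n - 1) with h1 | h1
      · rw [hrot'Int u h0 h1 _ (by omega) (by omega) (by omega)]
        simp [edgeLeft, edgeRight, h1, h0, rv, lv]
      · obtain rfl : u = n - 1 := by omega
        rw [hrot'Last _ (by omega) (by omega)]
        have h2 : 1 < n := hn
        simp [edgeLeft, edgeRight, lv, h2, Nat.sub_sub]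
  rot_inr q := hrot'Leaf q.1 q.2

theorem isHorizontalPath_of_rot (hn : 2 ≤ n)
    (hMrot0 : ∀ (h0 : 0 < n) (h1 : 1 < n), M.G.rot ⟨0, h0⟩ = [⟨1, h1⟩])
    (hMrotLast : ∀ (h1 : n - 1 < n) (h2 : n - 2 < n), M.G.rot ⟨n - 1, h1⟩ = [⟨n - 2, h2⟩])
    (hMrotInt : ∀ (u : ℕ) (_ : 0 < u) (_ : u < n - 1) (h0 : u < n) (h1 : u + 1 < n)
      (h2 : u - 1 < n), M.G.rot ⟨u, h0⟩ = [⟨u + 1, h1⟩, ⟨u - 1, h2⟩]) :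
    M.IsHorizontalPath := by
  rintro ⟨u, hu⟩
  rcases Nat.eq_zero_or_pos u with rfl | h0
  · rw [hMrot0 _ (by omega)]
    have h1 : (0 : ℕ) < n - 1 := by omega
    simp [edgeLeft, edgeRight, h1, rv]
  · rcases lt_or_ge u (n - 1) with h1 | h1
    · rw [hMrotInt u h0 h1 _ (by omega) (by omega)]
      simp [edgeLeft, edgeRight, h1, h0, rv, lv]
    · obtain rfl : u = n - 1 := by omega
      rw [hMrotLast _ (by omega)]
      have h2 : 1 < n := hn
      simp [edgeLeft, edgeRight, lv, h2, Nat.sub_sub]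

namespace IsRedCross

theorem cyclicAt_inl (hr : IsRedCross M M') (lay : M'.Layout) (u : Fin n) :
    cyclicAt lay (Sum.inl u) =
      slot lay (Sum.inl u) (edgeLeft u) (fun e => Sum.inr (e, 2)) ++
      (slot lay (Sum.inl u) (edgeRight u) (fun e => Sum.inr (e, 0)) ++
      (slot lay (Sum.inl u) (edgeRight u) (fun e => Sum.inl (rv e)) ++
      (slot lay (Sum.inl u) (edgeRight u) (fun e => Sum.inr (e, 1)) ++
      (slot lay (Sum.inl u) (edgeLeft u) (fun e => Sum.inr (e, 3)) ++
      slot lay (Sum.inl u) (edgeLeft u) (fun e => Sum.inl (lv e)))))) := by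
  simp [cyclicAt, hr.rot_inl u, slot, List.flatMap_append, List.flatMap_map]

theorem noAlternation_inr (hr : IsRedCross M M') (lay : M'.Layout) (q) (x y) :
    ¬ [x, y, x, y].Sublist (cyclicAt lay (Sum.inr q)) := by
  obtain ⟨w, hw⟩ := hr.rot_inr q
  simp only [cyclicAt, hw, List.flatMap_cons, List.flatMap_nil, List.append_nil]
  exact List.not_sublist_of_duplicate (x := x) (lay.nodup _ _) (by simp)

theorem uses_red_path (hr : IsRedCross M M') (e c b) :
    M'.usesEdge (Sum.inr (e, c, b)) (Sum.inl (lv e)) (Sum.inl (rv e)) :=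
  (hr.uses_red _ _ _ _ _).2 (Or.inl rfl)

variable {lay : M'.Layout}

theorem mem_ord_red_left (hr : IsRedCross M M') (e c b) :
    Sum.inr (e, c, b) ∈ lay.ord (Sum.inl (lv e)) (Sum.inl (rv e)) :=
  (lay.mem_iff _ _ _).2 (hr.uses_red_path e c b)

theorem mem_ord_red_right (hr : IsRedCross M M') (e c b) :
    Sum.inr (e, c, b) ∈ lay.ord (Sum.inl (rv e)) (Sum.inl (lv e)) :=
  (lay.mem_iff _ _ _).2 (usesEdge_comm.1 (hr.uses_red_path e c b))

section

open List

theorem red_left (hr : IsRedCross M M') (hlay : NoAlternation lay)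
    (e : Fin (n - 1)) (c c' : Fin ℓ) :
    [Sum.inr (e, c, true), Sum.inr (e, c', false)] <+
      lay.ord (Sum.inl (lv e)) (Sum.inl (rv e)) := by
  refine (pair_sublist_total (hr.mem_ord_red_left e c true) (hr.mem_ord_red_left e c' false)
    (by simp)).resolve_right fun hs => ?_
  refine hlay (Sum.inl (lv e)) (Sum.inr (e, c, true)) (Sum.inr (e, c', false)) (by simp) ?_
  rw [hr.cyclicAt_inl]
  have he : edgeRight (lv e) = some e := edgeRight_eq_some.2 rfl
  exact (nil_sublist _).append ((singleton_sublist.2 (mem_slot.2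
      ⟨e, he, (hr.uses_red _ _ _ _ _).2 (by simp)⟩)).append
    ((pair_sublist_slot.2 ⟨e, he, hs⟩).append ((singleton_sublist.2 (mem_slot.2
      ⟨e, he, (hr.uses_red _ _ _ _ _).2 (by simp)⟩)).append (nil_sublist _))))

theorem red_right (hr : IsRedCross M M') (hlay : NoAlternation lay)
    (e : Fin (n - 1)) (c c' : Fin ℓ) :
    [Sum.inr (e, c, true), Sum.inr (e, c', false)] <+
      lay.ord (Sum.inl (rv e)) (Sum.inl (lv e)) := by
  refine (pair_sublist_total (hr.mem_ord_red_right e c true) (hr.mem_ord_red_right e c' false)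
    (by simp)).resolve_right fun hs => ?_
  refine hlay (Sum.inl (rv e)) (Sum.inr (e, c', false)) (Sum.inr (e, c, true)) (by simp) ?_
  rw [hr.cyclicAt_inl]
  have he : edgeLeft (rv e) = some e := edgeLeft_eq_some.2 rfl
  exact (singleton_sublist.2 (mem_slot.2
      ⟨e, he, (hr.uses_red _ _ _ _ _).2 (by simp)⟩)).append
    ((nil_sublist _).append ((nil_sublist _).append ((nil_sublist _).append
    ((singleton_sublist.2 (mem_slot.2
      ⟨e, he, (hr.uses_red _ _ _ _ _).2 (by simp)⟩)).append
    (pair_sublist_slot.2 ⟨e, he, hs⟩)))))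

theorem old_left (hr : IsRedCross M M') (hlay : NoAlternation lay)
    {e e' : Fin (n - 1)} {i : ι} (he' : rv e' = lv e) (hi : M.usesEdge i (lv e) (rv e))
    (hi' : M.usesEdge i (lv e') (rv e')) (c : Fin ℓ) :
    [Sum.inr (e, c, true), Sum.inl i] <+ lay.ord (Sum.inl (lv e)) (Sum.inl (rv e)) ∧
    [Sum.inl i, Sum.inr (e, c, false)] <+ lay.ord (Sum.inl (lv e)) (Sum.inl (rv e)) := by
  have hm := (lay.mem_iff _ _ _).2 ((hr.uses_old _ _ _).2 hi)
  have he : edgeRight (lv e) = some e := edgeRight_eq_some.2 rfl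
  have hel : edgeLeft (lv e) = some e' := edgeLeft_eq_some.2 (by simp [← he'])
  have hiL : M'.usesEdge (Sum.inl i) (Sum.inl (lv e)) (Sum.inl (lv e')) :=
    (hr.uses_old _ _ _).2 (by rw [← he']; exact usesEdge_comm.1 hi')
  constructor
  · refine (pair_sublist_total (hr.mem_ord_red_left e c true) hm (by simp)).resolve_right
      fun hs => ?_
    refine hlay (Sum.inl (lv e)) (Sum.inr (e, c, true)) (Sum.inl i) (by simp) ?_
    rw [hr.cyclicAt_inl]
    exact (nil_sublist _).append ((singleton_sublist.2 (mem_slot.2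
        ⟨e, he, (hr.uses_red _ _ _ _ _).2 (by simp)⟩)).append
      ((pair_sublist_slot.2 ⟨e, he, hs⟩).append ((nil_sublist _).append ((nil_sublist _).append
      (singleton_sublist.2 (mem_slot.2 ⟨e', hel, hiL⟩))))))
  · refine (pair_sublist_total hm (hr.mem_ord_red_left e c false) (by simp)).resolve_right
      fun hs => ?_
    refine hlay (Sum.inl (lv e)) (Sum.inr (e, c, false)) (Sum.inl i) (by simp) ?_
    rw [hr.cyclicAt_inl]
    exact (nil_sublist _).append ((nil_sublist _).append
      ((pair_sublist_slot.2 ⟨e, he, hs⟩).append ((singleton_sublist.2 (mem_slot.2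
        ⟨e, he, (hr.uses_red _ _ _ _ _).2 (by simp)⟩)).append ((nil_sublist _).append
      (singleton_sublist.2 (mem_slot.2 ⟨e', hel, hiL⟩))))))

theorem old_right (hr : IsRedCross M M') (hlay : NoAlternation lay)
    {e e' : Fin (n - 1)} {i : ι} (he' : lv e' = rv e) (hi : M.usesEdge i (lv e) (rv e))
    (hi' : M.usesEdge i (lv e') (rv e')) (c : Fin ℓ) :
    [Sum.inr (e, c, true), Sum.inl i] <+ lay.ord (Sum.inl (rv e)) (Sum.inl (lv e)) ∧
    [Sum.inl i, Sum.inr (e, c, false)] <+ lay.ord (Sum.inl (rv e)) (Sum.inl (lv e)) := by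
  have hm := (lay.mem_iff _ _ _).2 ((hr.uses_old _ _ _).2 (usesEdge_comm.1 hi))
  have he : edgeLeft (rv e) = some e := edgeLeft_eq_some.2 rfl
  have her : edgeRight (rv e) = some e' := edgeRight_eq_some.2 (by simp [← he'])
  have hiR : M'.usesEdge (Sum.inl i) (Sum.inl (rv e)) (Sum.inl (rv e')) :=
    (hr.uses_old _ _ _).2 (by rw [← he']; exact hi')
  constructor
  · refine (pair_sublist_total (hr.mem_ord_red_right e c true) hm (by simp)).resolve_right
      fun hs => ?_
    refine hlay (Sum.inl (rv e)) (Sum.inl i) (Sum.inr (e, c, true)) (by simp) ?_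
    rw [hr.cyclicAt_inl]
    exact (nil_sublist _).append ((nil_sublist _).append
      ((singleton_sublist.2 (mem_slot.2 ⟨e', her, hiR⟩)).append ((nil_sublist _).append
      ((singleton_sublist.2 (mem_slot.2
        ⟨e, he, (hr.uses_red _ _ _ _ _).2 (by simp)⟩)).append
      (pair_sublist_slot.2 ⟨e, he, hs⟩)))))
  · refine (pair_sublist_total hm (hr.mem_ord_red_right e c false) (by simp)).resolve_right
      fun hs => ?_
    refine hlay (Sum.inl (rv e)) (Sum.inr (e, c, false)) (Sum.inl i) (by simp) ?_
    rw [hr.cyclicAt_inl]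
    exact (singleton_sublist.2 (mem_slot.2
        ⟨e, he, (hr.uses_red _ _ _ _ _).2 (by simp)⟩)).append
      ((nil_sublist _).append ((singleton_sublist.2 (mem_slot.2 ⟨e', her, hiR⟩)).append
      ((nil_sublist _).append ((nil_sublist _).append (pair_sublist_slot.2 ⟨e, he, hs⟩)))))

end

end IsRedCross

end RedCross

end MLCMInstance

theorem Nat.card_subtype_comp_le {α β : Type*} [Finite β] {f : α → β} (hf : Function.Injective f)
    (p : β → Prop) : Nat.card {a // p (f a)} ≤ Nat.card {b // p b} :=
  Nat.card_le_card_of_injective (fun a : {a // p (f a)} => (⟨f a.1, a.2⟩ : {b // p b}))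
    fun a b h => Subtype.ext (hf (by simpa using h))

theorem Nat.card_subtype_comp_eq {α β : Type*} [Finite α] [Finite β] {f : α → β}
    (hf : Function.Injective f) {p : β → Prop} (hp : ∀ b, p b → ∃ a, f a = b) :
    Nat.card {a // p (f a)} = Nat.card {b // p b} := by
  refine le_antisymm (Nat.card_subtype_comp_le hf p) (Nat.card_le_card_of_surjective
    (fun a : {a // p (f a)} => (⟨f a.1, a.2⟩ : {b // p b})) ?_)
  rintro ⟨b, hb⟩
  obtain ⟨a, rfl⟩ := hp b hb
  exact ⟨⟨a, hb⟩, rfl⟩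

theorem Nat.card_subtype_sum {α β : Type*} [Finite α] [Finite β] (p : α ⊕ β → Prop) :
    Nat.card {x // p x} = Nat.card {a // p (Sum.inl a)} + Nat.card {b // p (Sum.inr b)} := by
  rw [Nat.card_congr Equiv.subtypeSum, Nat.card_sum]

theorem Nat.card_subtype_prod {α β : Type*} [Fintype α] [Finite β] (p : α → β → Prop) :
    Nat.card {x : α × β // p x.1 x.2} = ∑ a, Nat.card {b // p a b} := by
  rw [Nat.card_congr (Equiv.subtypeProdEquivSigmaSubtype p), Nat.card_sigma]

open Classical in
theorem Nat.card_subtype_eq_sum {α : Type*} [Fintype α] (p : α → Prop) :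
    Nat.card {x // p x} = ∑ a, if p a then 1 else 0 := by
  rw [Nat.card_eq_fintype_card, Fintype.card_subtype, Finset.card_filter]

namespace MLCMInstance

section Counting

variable {n ℓ : ℕ} {ι : Type} {M : MLCMInstance (Fin n) ι}
  {M' : MLCMInstance (Fin n ⊕ (Fin (n - 1) × Fin 4)) (ι ⊕ (Fin (n - 1) × Fin ℓ × Bool))}

/-- The old line `i` crosses the red line `(e, q)` on the path edge `e`, above it on the left if
`q` runs downwards and below it on the left otherwise. -/
def RedCrossing (lay : M'.Layout) (e : Fin (n - 1)) (i : ι) (q : Fin ℓ × Bool) : Prop :=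
  if q.2 then EdgeCross lay (Sum.inr (e, q.1, true)) (Sum.inl i) (Sum.inl (lv e)) (Sum.inl (rv e))
  else EdgeCross lay (Sum.inl i) (Sum.inr (e, q.1, false)) (Sum.inl (lv e)) (Sum.inl (rv e))

/-- Pairs of lines on the path edge `e` that may cross there: two old lines, a downward and an
upward red line, or an old line and a red line. -/
def crossingPair (e : Fin (n - 1)) :
    (ι × ι) ⊕ ((Fin ℓ × Fin ℓ) ⊕ (ι × (Fin ℓ × Bool))) →
      (ι ⊕ (Fin (n - 1) × Fin ℓ × Bool)) × (ι ⊕ (Fin (n - 1) × Fin ℓ × Bool))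
  | Sum.inl (i, j) => (Sum.inl i, Sum.inl j)
  | Sum.inr (Sum.inl (c, c')) => (Sum.inr (e, c, true), Sum.inr (e, c', false))
  | Sum.inr (Sum.inr (i, c, true)) => (Sum.inr (e, c, true), Sum.inl i)
  | Sum.inr (Sum.inr (i, c, false)) => (Sum.inl i, Sum.inr (e, c, false))

theorem crossingPair_injective (e : Fin (n - 1)) :
    Function.Injective (crossingPair (ℓ := ℓ) (ι := ι) e) := by
  rintro (⟨i, j⟩ | ⟨c, c'⟩ | ⟨i, c, _ | _⟩) (⟨i, j⟩ | ⟨c, c'⟩ | ⟨i, c, _ | _⟩) h <;>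
    simp_all [crossingPair]

theorem card_crossingPair [Fintype ι] {lay : M'.Layout} {e : Fin (n - 1)}
    (hred : ∀ c c', EdgeCross lay (Sum.inr (e, c, true)) (Sum.inr (e, c', false))
      (Sum.inl (lv e)) (Sum.inl (rv e))) :
    Nat.card {x // EdgeCross lay (crossingPair e x).1 (crossingPair e x).2
      (Sum.inl (lv e)) (Sum.inl (rv e))} =
    Nat.card {q : ι × ι // EdgeCross lay (Sum.inl q.1) (Sum.inl q.2)
      (Sum.inl (lv e)) (Sum.inl (rv e))} +
    (ℓ ^ 2 + ∑ i, Nat.card {q // RedCrossing lay e i q}) := by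
  rw [Nat.card_subtype_sum, Nat.card_subtype_sum]
  congr 2
  · have : ∀ b : Fin ℓ × Fin ℓ, EdgeCross lay (crossingPair e (Sum.inr (Sum.inl b))).1
        (crossingPair (ι := ι) e (Sum.inr (Sum.inl b))).2 (Sum.inl (lv e)) (Sum.inl (rv e)) :=
      fun b => hred b.1 b.2
    rw [Nat.card_congr (Equiv.subtypeUnivEquiv this)]
    simp [sq]
  · rw [← Nat.card_subtype_prod]
    refine Nat.card_congr (Equiv.subtypeEquivRight ?_)
    rintro ⟨i, c, _ | _⟩ <;> simp [RedCrossing, crossingPair]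

theorem le_card_redCrossing {lay : M'.Layout} {e : Fin (n - 1)} {i : ι}
    (h : ∀ c, RedCrossing lay e i (c, true) ∨ RedCrossing lay e i (c, false)) :
    ℓ ≤ Nat.card {q // RedCrossing lay e i q} := by
  have : ∀ c, ∃ b, RedCrossing lay e i (c, b) := fun c => (h c).elim (⟨_, ·⟩) (⟨_, ·⟩)
  choose b hb using this
  simpa using Nat.card_le_card_of_injective
    (fun c : Fin ℓ => (⟨(c, b c), hb c⟩ : {q // RedCrossing lay e i q}))
    (fun c c' h => by simp at h; exact h.1)

theorem card_redCrossing_of_iff {lay : M'.Layout} {e : Fin (n - 1)} {i : ι} {b : Bool}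
    (h : ∀ q, RedCrossing lay e i q ↔ q.2 = b) : Nat.card {q // RedCrossing lay e i q} = ℓ := by
  have : Nat.card (Fin ℓ) = Nat.card {q // RedCrossing lay e i q} :=
    Nat.card_congr ⟨fun c => ⟨(c, b), (h _).2 rfl⟩, fun q => q.1.1, fun c => rfl, by
      rintro ⟨⟨c, b'⟩, hq⟩
      obtain rfl : b' = b := (h _).1 hq
      rfl⟩
  simpa using this.symm

theorem card_redCrossing_of_forall {lay : M'.Layout} {e : Fin (n - 1)} {i : ι}
    (h : ∀ q, RedCrossing lay e i q) : Nat.card {q // RedCrossing lay e i q} = 2 * ℓ := by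
  rw [Nat.card_congr (Equiv.subtypeUnivEquiv h)]
  simp [mul_comm]

open Classical in
/-- The number of red lines on `e` which the line `i` has to cross there. -/
noncomputable def weight (M : MLCMInstance (Fin n) ι) (ℓ : ℕ) (e : Fin (n - 1)) (i : ι) : ℕ :=
  if M.usesEdge i (lv e) (rv e) then
    if M.Terminal i (lv e) ∨ M.Terminal i (rv e) then ℓ else 2 * ℓ
  else 0

theorem Kconst_eq [Fintype ι] (M : MLCMInstance (Fin n) ι) :
    M.Kconst = ∑ e, ((Nat.card ι ^ 2) ^ 2 + ∑ i, weight M (Nat.card ι ^ 2) e i) := by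
  classical
  rw [Kconst, Finset.sum_add_distrib]
  congr 1
  · simp
  · refine Finset.sum_congr rfl fun e _ => ?_
    rw [termLineCount, midLineCount, Nat.card_subtype_eq_sum, Nat.card_subtype_eq_sum,
      Finset.mul_sum, ← Finset.sum_add_distrib, Finset.sum_mul]
    refine Finset.sum_congr rfl fun i _ => ?_
    unfold weight
    unfold lv rv
    split_ifs <;> simp_all

end Counting

end MLCMInstance

theorem List.Nodup.exists_rank {α : Type*} {l : List α} (hl : l.Nodup) :
    ∃ r : α → ℤ, ∀ x ∈ l, ∀ y ∈ l, [x, y].Sublist l ↔ r x < r y := by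
  classical
  have fwd : ∀ l : List α, l.Nodup → ∀ x y, [x, y].Sublist l → l.idxOf x < l.idxOf y := by
    intro l
    induction l with
    | nil => intro _ x y h; simp at h
    | cons a l ih =>
      intro hl x y h
      have hl' := List.nodup_cons.1 hl
      rcases List.cons_sublist_cons'.1 h with hs | ⟨rfl, hs⟩
      · have hm := List.mem_of_pair_sublist hs
        rw [List.idxOf_cons_ne _ (by rintro rfl; exact hl'.1 hm.1),
          List.idxOf_cons_ne _ (by rintro rfl; exact hl'.1 hm.2)]
        exact Nat.succ_lt_succ (ih hl'.2 x y hs)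
      · have hm := List.singleton_sublist.1 hs
        rw [List.idxOf_cons_self, List.idxOf_cons_ne _ (by rintro rfl; exact hl'.1 hm)]
        exact Nat.succ_pos _
  refine ⟨fun x => (l.idxOf x : ℤ), fun x hx y hy => ?_⟩
  rw [Nat.cast_lt]
  refine ⟨fwd l hl x y, fun h => ?_⟩
  rcases List.pair_sublist_total hx hy (by rintro rfl; exact lt_irrefl _ h) with h' | h'
  · exact h'
  · exact absurd (fwd l hl _ _ h') h.not_gt

namespace MLCMInstance

section General

variable {V ι : Type} {M : MLCMInstance V ι}

theorem Periphery.exists_group {lay : M.Layout} (h : Periphery lay) :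
    ∃ g : V → V → ι → ℤ, ∀ u v,
      (∀ i, M.usesEdge i u v → M.Terminal i u → g u v i = 0 ∨ g u v i = 4) ∧
      (∀ i, M.usesEdge i u v → ¬ M.Terminal i u → g u v i = 2) ∧
      (∀ i j, [i, j].Sublist (lay.ord u v) → g u v i ≤ g u v j) := by
  classical
  choose s₁ s₂ s₃ hs h1 h2 h3 using h
  refine ⟨fun u v i => if i ∈ s₁ u v then 0 else if i ∈ s₂ u v then 2 else 4, fun u v => ?_⟩
  have hnd := lay.nodup u v
  have hmem : ∀ i, M.usesEdge i u v → i ∈ s₁ u v ∨ i ∈ s₂ u v ∨ i ∈ s₃ u v := by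
    intro i hi
    have := (lay.mem_iff u v i).2 hi
    rw [hs] at this
    simpa [or_assoc] using this
  have h1 := h1 u v
  have h2 := h2 u v
  have h3 := h3 u v
  refine ⟨?_, ?_, ?_⟩
  · intro i hi ht
    have := hmem i hi
    have := h2 i
    dsimp only
    split_ifs <;> simp_all
  · intro i hi ht
    have := hmem i hi
    have := h1 i
    have := h3 i
    dsimp only
    split_ifs <;> simp_all
  · intro i j hij
    rw [hs, List.pair_sublist_append_iff, List.pair_sublist_append_iff] at hij
    rw [hs, List.nodup_append, List.nodup_append] at hnd
    obtain ⟨⟨-, -, hd⟩, -, hd'⟩ := hnd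
    have d12 : ∀ x, x ∈ s₁ u v → x ∈ s₂ u v → False := fun x h h' => hd x h x h' rfl
    have d3 : ∀ x, x ∈ s₃ u v → x ∉ s₁ u v ∧ x ∉ s₂ u v := fun x h =>
      ⟨fun h' => hd' x (List.mem_append_left _ h') x h rfl,
        fun h' => hd' x (List.mem_append_right _ h') x h rfl⟩
    have c : (i ∈ s₁ u v ∧ j ∈ s₁ u v) ∨ (i ∈ s₂ u v ∧ j ∈ s₂ u v) ∨ (i ∈ s₁ u v ∧ j ∈ s₂ u v) ∨
        j ∈ s₃ u v := by
      rcases hij with (h | h | h) | h | h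
      · exact Or.inl (List.mem_of_pair_sublist h)
      · exact Or.inr (Or.inl (List.mem_of_pair_sublist h))
      · exact Or.inr (Or.inr (Or.inl h))
      · exact Or.inr (Or.inr (Or.inr (List.mem_of_pair_sublist h).2))
      · exact Or.inr (Or.inr (Or.inr h.2))
    rcases c with ⟨hi, hj⟩ | ⟨hi, hj⟩ | ⟨hi, hj⟩ | hj
    · simp [hi, hj]
    · have := d12 i
      have := d12 j
      simp_all
    · have := d12 j
      simp_all
    · have := d3 j hj
      simp only [this, if_false]
      split_ifs <;> simp

end General

section Lift

variable {n ℓ : ℕ} {ι : Type} {M : MLCMInstance (Fin n) ι}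
  {M' : MLCMInstance (Fin n ⊕ (Fin (n - 1) × Fin 4)) (ι ⊕ (Fin (n - 1) × Fin ℓ × Bool))}

/-- Whether equally directed red lines appear in increasing or decreasing order at a port. -/
def redSign : Fin n ⊕ (Fin (n - 1) × Fin 4) → Fin n ⊕ (Fin (n - 1) × Fin 4) → ℤ
  | Sum.inl a, Sum.inl b => if a.val < b.val then 1 else -1
  | Sum.inl _, Sum.inr (_, p) => if p.val ≤ 1 then -1 else 1
  | Sum.inr (_, p), Sum.inl _ => if p.val ≤ 1 then 1 else -1
  | Sum.inr _, Sum.inr _ => 1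

theorem redSign_eq (x y : Fin n ⊕ (Fin (n - 1) × Fin 4)) : redSign x y = 1 ∨ redSign x y = -1 := by
  rcases x with a | ⟨e, p⟩ <;> rcases y with b | ⟨e', p'⟩ <;> simp only [redSign] <;>
    (try split_ifs) <;> simp

/-- The position of a line at a port when the red lines are inserted next to the lines of
group `2`. -/
def liftKey (g r : Fin n → Fin n → ι → ℤ) (x y : Fin n ⊕ (Fin (n - 1) × Fin 4)) :
    ι ⊕ (Fin (n - 1) × Fin ℓ × Bool) → ℤ ×ₗ ℤ
  | Sum.inl i =>
    match x, y with
    | Sum.inl a, Sum.inl b => toLex (g a b i, r a b i)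
    | _, _ => toLex (0, 0)
  | Sum.inr (_, c, b) => toLex (if b then 1 else 3, redSign x y * c.val)

namespace IsRedCross

theorem red_edge_unique (hr : IsRedCross M M') {e e' : Fin (n - 1)} {c c' : Fin ℓ} {b b' : Bool}
    {x y} (h : M'.usesEdge (Sum.inr (e, c, b)) x y) (h' : M'.usesEdge (Sum.inr (e', c', b')) x y) :
    e = e' := by
  rw [hr.uses_red] at h h'
  rcases h with h | h | h <;> rw [h] at h' <;>
    simp [Fin.ext_iff] at h' <;> ext <;> omega

theorem not_uses_old_left (hr : IsRedCross M M') (i : ι) (x q) :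
    ¬ M'.usesEdge (Sum.inl i) (Sum.inr q) x := fun h =>
  hr.not_uses_old i x q (usesEdge_comm.1 h)

/-- Existence of a layout of `M'` extending `lay`, described by its pairwise port orders. -/
theorem exists_lift_order [Finite ι] (hr : IsRedCross M M') {lay : M.Layout}
    (hper : Periphery lay) :
    ∃ (g : Fin n → Fin n → ι → ℤ) (lay' : M'.Layout),
      (∀ u v i, M.usesEdge i u v → M.Terminal i u → g u v i = 0 ∨ g u v i = 4) ∧
      (∀ u v i, M.usesEdge i u v → ¬ M.Terminal i u → g u v i = 2) ∧
      (∀ u v i j, [Sum.inl i, Sum.inl j].Sublist (lay'.ord (Sum.inl u) (Sum.inl v)) ↔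
        [i, j].Sublist (lay.ord u v)) ∧
      (∀ u v i e c b, [Sum.inl i, Sum.inr (e, c, b)].Sublist (lay'.ord (Sum.inl u) (Sum.inl v)) ↔
        M.usesEdge i u v ∧ M'.usesEdge (Sum.inr (e, c, b)) (Sum.inl u) (Sum.inl v) ∧
          g u v i < if b then 1 else 3) ∧
      (∀ u v i e c b, [Sum.inr (e, c, b), Sum.inl i].Sublist (lay'.ord (Sum.inl u) (Sum.inl v)) ↔
        M'.usesEdge (Sum.inr (e, c, b)) (Sum.inl u) (Sum.inl v) ∧ M.usesEdge i u v ∧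
          (if b then 1 else 3) < g u v i) ∧
      (∀ x y e c b e' c' b', [Sum.inr (e, c, b), Sum.inr (e', c', b')].Sublist (lay'.ord x y) ↔
        M'.usesEdge (Sum.inr (e, c, b)) x y ∧ M'.usesEdge (Sum.inr (e', c', b')) x y ∧
          ((b = true ∧ b' = false) ∨
            (b = b' ∧ redSign x y * (c.val : ℤ) < redSign x y * (c'.val : ℤ)))) := by
  obtain ⟨g, hg⟩ := hper.exists_group
  choose r hrk using fun u v => (lay.nodup u v).exists_rank
  have hgv : ∀ u v i, M.usesEdge i u v → g u v i = 0 ∨ g u v i = 2 ∨ g u v i = 4 := by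
    intro u v i hi
    have h1 := (hg u v).1 i hi
    have h2 := (hg u v).2.1 i hi
    by_cases ht : M.Terminal i u <;> grind
  obtain ⟨lay', hlay'⟩ := exists_layout_of_key M' (liftKey g r) (by
    rintro x y (i | ⟨e, c, b⟩) (j | ⟨e', c', b'⟩) hi hj h
    · match x, y, hi, hj, h with
      | Sum.inl u, Sum.inl v, hi, hj, h =>
        rw [hr.uses_old, ← lay.mem_iff] at hi hj
        simp only [liftKey, toLex_inj, Prod.mk.injEq] at h
        by_contra hij
        rcases List.pair_sublist_total hi hj (fun h' => hij (by rw [h'])) with h' | h'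
        · exact absurd ((hrk u v i hi j hj).1 h') (by omega)
        · exact absurd ((hrk u v j hj i hi).1 h') (by omega)
      | x, Sum.inr q, hi, _, _ => exact absurd hi (hr.not_uses_old _ _ _)
      | Sum.inr q, y, hi, _, _ => exact absurd hi (hr.not_uses_old_left _ _ _)
    · match x, y, hi, h with
      | Sum.inl u, Sum.inl v, hi, h =>
        have := hgv u v i ((hr.uses_old _ _ _).1 hi)
        simp only [liftKey, toLex_inj, Prod.mk.injEq] at h
        split_ifs at h <;> omega
      | x, Sum.inr q, hi, _ => exact absurd hi (hr.not_uses_old _ _ _)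
      | Sum.inr q, y, hi, _ => exact absurd hi (hr.not_uses_old_left _ _ _)
    · match x, y, hj, h with
      | Sum.inl u, Sum.inl v, hj, h =>
        have := hgv u v j ((hr.uses_old _ _ _).1 hj)
        simp only [liftKey, toLex_inj, Prod.mk.injEq] at h
        split_ifs at h <;> omega
      | x, Sum.inr q, hj, _ => exact absurd hj (hr.not_uses_old _ _ _)
      | Sum.inr q, y, hj, _ => exact absurd hj (hr.not_uses_old_left _ _ _)
    · obtain rfl := hr.red_edge_unique hi hj
      simp only [liftKey, toLex_inj, Prod.mk.injEq] at h
      have hb : b = b' := by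
        have := h.1
        cases b <;> cases b' <;> simp_all
      have hc : c = c' := by
        rcases redSign_eq x y with hs | hs <;> rw [hs] at h <;> ext <;> omega
      rw [hb, hc])
  refine ⟨g, lay', fun u v => (hg u v).1, fun u v => (hg u v).2.1, ?_, ?_, ?_, ?_⟩
  · intro u v i j
    rw [hlay', hr.uses_old, hr.uses_old, ← lay.mem_iff, ← lay.mem_iff]
    simp only [liftKey, Prod.Lex.toLex_lt_toLex]
    have hgi := (hg u v).2.2
    constructor
    · rintro ⟨hi, hj, h⟩
      rcases h with h | h
      · rcases List.pair_sublist_total hi hj (by rintro rfl; exact lt_irrefl _ h) with h' | h'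
        · exact h'
        · exact absurd (hgi _ _ h') (by omega)
      · exact (hrk u v i hi j hj).2 h.2
    · intro h
      have hm := List.mem_of_pair_sublist h
      refine ⟨hm.1, hm.2, ?_⟩
      have h1 := hgi _ _ h
      have h2 := (hrk u v i hm.1 j hm.2).1 h
      omega
  · intro u v i e c b
    rw [hlay', hr.uses_old]
    simp only [liftKey, Prod.Lex.toLex_lt_toLex]
    refine and_congr_right fun hi => and_congr_right fun _ => ?_
    have := hgv u v i hi
    split_ifs <;> omega
  · intro u v i e c b
    rw [hlay', hr.uses_old]
    simp only [liftKey, Prod.Lex.toLex_lt_toLex]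
    refine and_congr_right fun _ => and_congr_right fun hi => ?_
    have := hgv u v i hi
    split_ifs <;> omega
  · intro x y e c b e' c' b'
    rw [hlay']
    simp only [liftKey, Prod.Lex.toLex_lt_toLex]
    cases b <;> cases b' <;> simp

end IsRedCross

end Lift

end MLCMInstance

namespace MLCMInstance

section LiftNoAlternation

variable {n ℓ : ℕ} {ι : Type} {M : MLCMInstance (Fin n) ι}
  {M' : MLCMInstance (Fin n ⊕ (Fin (n - 1) × Fin 4)) (ι ⊕ (Fin (n - 1) × Fin ℓ × Bool))}

namespace IsRedCross

theorem mem_slots_red (hr : IsRedCross M M') (lay : M'.Layout) (u : Fin n) (e c b) :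
    (Sum.inr (e, c, b) ∈ slot lay (Sum.inl u) (edgeLeft u) (fun e => Sum.inr (e, 2)) ↔
      e.val + 1 = u.val ∧ b = false) ∧
    (Sum.inr (e, c, b) ∈ slot lay (Sum.inl u) (edgeRight u) (fun e => Sum.inr (e, 0)) ↔
      e.val = u.val ∧ b = true) ∧
    (Sum.inr (e, c, b) ∈ slot lay (Sum.inl u) (edgeRight u) (fun e => Sum.inl (rv e)) ↔
      e.val = u.val) ∧
    (Sum.inr (e, c, b) ∈ slot lay (Sum.inl u) (edgeRight u) (fun e => Sum.inr (e, 1)) ↔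
      e.val = u.val ∧ b = false) ∧
    (Sum.inr (e, c, b) ∈ slot lay (Sum.inl u) (edgeLeft u) (fun e => Sum.inr (e, 3)) ↔
      e.val + 1 = u.val ∧ b = true) ∧
    (Sum.inr (e, c, b) ∈ slot lay (Sum.inl u) (edgeLeft u) (fun e => Sum.inl (lv e)) ↔
      e.val + 1 = u.val) := by
  simp only [mem_slot, edgeLeft_eq_some, edgeRight_eq_some, hr.uses_red]
  refine ⟨?_, ?_, ?_, ?_, ?_, ?_⟩ <;> constructor
  all_goals first
    | rintro ⟨e', h1, h2⟩
      cases b <;> simp [Fin.ext_iff] at h2 ⊢ <;> omega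
    | intro h
      refine ⟨e, by omega, ?_⟩
      cases b <;> simp_all [Fin.ext_iff]

theorem mem_slots_old (hr : IsRedCross M M') {lo hi : ι → ℕ} (hM : M.IsSpan lo hi)
    (lay : M'.Layout) (u : Fin n) (i : ι) :
    (∀ o p, Sum.inl i ∉ slot lay (Sum.inl u) o (fun e => Sum.inr (e, p))) ∧
    (Sum.inl i ∈ slot lay (Sum.inl u) (edgeRight u) (fun e => Sum.inl (rv e)) →
      lo i ≤ u.val ∧ u.val < hi i) ∧
    (Sum.inl i ∈ slot lay (Sum.inl u) (edgeLeft u) (fun e => Sum.inl (lv e)) →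
      lo i < u.val ∧ u.val ≤ hi i) := by
  simp only [mem_slot, edgeLeft_eq_some, edgeRight_eq_some, hr.uses_old, hr.not_uses_old,
    hM.uses_iff, val_lv, val_rv]
  refine ⟨by simp, ?_, ?_⟩ <;> rintro ⟨e, h1, h2⟩ <;> omega

open List in
theorem noAlternation_of_order (hr : IsRedCross M M') (hrot : M.IsHorizontalPath)
    {lo hi : ι → ℕ} (hM : M.IsSpan lo hi) {lay : M.Layout} (hlay : NoAlternation lay)
    {lay' : M'.Layout} {g : Fin n → Fin n → ι → ℤ}
    (hg : ∀ u v i, M.usesEdge i u v → ¬ M.Terminal i u → g u v i = 2)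
    (hoo : ∀ u v i j, [Sum.inl i, Sum.inl j] <+ lay'.ord (Sum.inl u) (Sum.inl v) →
      [i, j] <+ lay.ord u v)
    (hor : ∀ u v i e c b, [Sum.inl i, Sum.inr (e, c, b)] <+ lay'.ord (Sum.inl u) (Sum.inl v) →
      g u v i < if b then 1 else 3)
    (hro : ∀ u v i e c b, [Sum.inr (e, c, b), Sum.inl i] <+ lay'.ord (Sum.inl u) (Sum.inl v) →
      (if b then 1 else 3) < g u v i)
    (hrr : ∀ x y e c b e' c' b', [Sum.inr (e, c, b), Sum.inr (e', c', b')] <+ lay'.ord x y →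
      ((b = true ∧ b' = false) ∨
        (b = b' ∧ redSign x y * (c.val : ℤ) < redSign x y * (c'.val : ℤ)))) :
    NoAlternation lay' := by
  rintro (u | q) x y hxy h
  swap
  · exact hr.noAlternation_inr lay' q x y h
  rw [hr.cyclicAt_inl] at h
  have mr := hr.mem_slots_red lay' u
  have mo := hr.mem_slots_old hM lay' u
  have hnt : ∀ v i, M.usesEdge i u v → lo i < u.val → u.val < hi i → g u v i = 2 :=
    fun v i h h1 h2 => hg u v i h (by rw [hM.terminal_iff]; omega)
  have oC : ∀ i j, [Sum.inl i, Sum.inl j] <+ slot lay' (Sum.inl u) (edgeRight u)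
      (fun e => Sum.inl (rv e)) → [i, j] <+ slot lay u (edgeRight u) rv := by
    intro i j h
    obtain ⟨e, he, h⟩ := pair_sublist_slot.1 h
    exact pair_sublist_slot.2 ⟨e, he, hoo _ _ _ _ h⟩
  have oF : ∀ i j, [Sum.inl i, Sum.inl j] <+ slot lay' (Sum.inl u) (edgeLeft u)
      (fun e => Sum.inl (lv e)) → [i, j] <+ slot lay u (edgeLeft u) lv := by
    intro i j h
    obtain ⟨e, he, h⟩ := pair_sublist_slot.1 h
    exact pair_sublist_slot.2 ⟨e, he, hoo _ _ _ _ h⟩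
  have or' : ∀ i e c b o (f : Fin (n - 1) → Fin n), [Sum.inl i, Sum.inr (e, c, b)] <+
      slot lay' (Sum.inl u) o (fun e => Sum.inl (f e)) →
      lo i < u.val → u.val < hi i → b = false := by
    intro i e c b o f h h1 h2
    obtain ⟨e', he, h⟩ := pair_sublist_slot.1 h
    have h3 := hor _ _ _ _ _ _ h
    rw [hnt _ _ ((hr.uses_old _ _ _).1 ((lay'.mem_iff _ _ _).1 (mem_of_pair_sublist h).1)) h1 h2]
      at h3
    cases b
    · rfl
    · simp at h3
  have ro' : ∀ i e c b o (f : Fin (n - 1) → Fin n), [Sum.inr (e, c, b), Sum.inl i] <+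
      slot lay' (Sum.inl u) o (fun e => Sum.inl (f e)) →
      lo i < u.val → u.val < hi i → b = true := by
    intro i e c b o f h h1 h2
    obtain ⟨e', he, h⟩ := pair_sublist_slot.1 h
    have h3 := hro _ _ _ _ _ _ h
    rw [hnt _ _ ((hr.uses_old _ _ _).1 ((lay'.mem_iff _ _ _).1 (mem_of_pair_sublist h).2)) h1 h2]
      at h3
    cases b
    · simp at h3
    · rfl
  have rr : ∀ e c b e' c' b' (o : Option (Fin (n - 1))) f (s : ℤ),
      (∀ v, o = some v → redSign (Sum.inl u) (f v) = s) →
      [Sum.inr (e, c, b), Sum.inr (e', c', b')] <+ slot lay' (Sum.inl u) o f →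
      ((b = true ∧ b' = false) ∨ (b = b' ∧ s * (c.val : ℤ) < s * (c'.val : ℤ))) := by
    intro e c b e' c' b' o f s hs h
    obtain ⟨v, hv, h⟩ := pair_sublist_slot.1 h
    rw [← hs v hv]
    exact hrr _ _ _ _ _ _ _ _ h
  have rA := fun e c b e' c' b' => rr e c b e' c' b' (edgeLeft u) (fun e => Sum.inr (e, 2)) 1
    (fun _ _ => rfl)
  have rB := fun e c b e' c' b' => rr e c b e' c' b' (edgeRight u) (fun e => Sum.inr (e, 0)) (-1)
    (fun _ _ => rfl)
  have rC := fun e c b e' c' b' => rr e c b e' c' b' (edgeRight u) (fun e => Sum.inl (rv e)) 1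
    (fun v hv => if_pos (by rw [edgeRight_eq_some] at hv; rw [val_rv]; omega))
  have rD := fun e c b e' c' b' => rr e c b e' c' b' (edgeRight u) (fun e => Sum.inr (e, 1)) (-1)
    (fun _ _ => rfl)
  have rE := fun e c b e' c' b' => rr e c b e' c' b' (edgeLeft u) (fun e => Sum.inr (e, 3)) 1
    (fun _ _ => rfl)
  have rF := fun e c b e' c' b' => rr e c b e' c' b' (edgeLeft u) (fun e => Sum.inl (lv e)) (-1)
    (fun v hv => if_neg (by rw [edgeLeft_eq_some] at hv; rw [val_lv]; omega))
  clear rr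
  have orC := fun i e c b => or' i e c b (edgeRight u) rv
  have orF := fun i e c b => or' i e c b (edgeLeft u) lv
  have roC := fun i e c b => ro' i e c b (edgeRight u) rv
  have roF := fun i e c b => ro' i e c b (edgeLeft u) lv
  clear or' ro'
  have key : ∀ i j, i ≠ j → [i, j] <+ slot lay u (edgeRight u) rv →
      ¬ [i, j] <+ slot lay u (edgeLeft u) lv :=
    fun i j hij h1 h2 => hlay u i j hij (by rw [hrot.cyclicAt_eq]; exact h1.append h2)
  have oo : ∀ i j, i ≠ j → [Sum.inl i, Sum.inl j] <+ slot lay' (Sum.inl u) (edgeRight u)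
      (fun e => Sum.inl (rv e)) → ¬ [Sum.inl i, Sum.inl j] <+ slot lay' (Sum.inl u) (edgeLeft u)
      (fun e => Sum.inl (lv e)) :=
    fun i j hij h1 h2 => key i j hij (oC i j h1) (oF i j h2)
  have nA := nodup_slot lay' (Sum.inl u) (edgeLeft u) (fun e => Sum.inr (e, 2))
  have nB := nodup_slot lay' (Sum.inl u) (edgeRight u) (fun e => Sum.inr (e, 0))
  have nC := nodup_slot lay' (Sum.inl u) (edgeRight u) (fun e => Sum.inl (rv e))
  have nD := nodup_slot lay' (Sum.inl u) (edgeRight u) (fun e => Sum.inr (e, 1))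
  have nE := nodup_slot lay' (Sum.inl u) (edgeLeft u) (fun e => Sum.inr (e, 3))
  have nF := nodup_slot lay' (Sum.inl u) (edgeLeft u) (fun e => Sum.inl (lv e))
  have moA := fun i => (mo i).1 (edgeLeft u) 2
  have moB := fun i => (mo i).1 (edgeRight u) 0
  have moD := fun i => (mo i).1 (edgeRight u) 1
  have moE := fun i => (mo i).1 (edgeLeft u) 3
  replace mo := fun i => (mo i).2
  clear key oC oF hnt hg hoo hor hro hrr hlay
  generalize slot lay' (Sum.inl u) (edgeLeft u) (fun e => Sum.inr (e, 2)) = A at *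
  generalize slot lay' (Sum.inl u) (edgeRight u) (fun e => Sum.inr (e, 0)) = B at *
  generalize slot lay' (Sum.inl u) (edgeRight u) (fun e => Sum.inl (rv e)) = C at *
  generalize slot lay' (Sum.inl u) (edgeRight u) (fun e => Sum.inr (e, 1)) = D at *
  generalize slot lay' (Sum.inl u) (edgeLeft u) (fun e => Sum.inr (e, 3)) = E at *
  generalize slot lay' (Sum.inl u) (edgeLeft u) (fun e => Sum.inl (lv e)) = F at *
  clear lay' lay hM hrot hr g
  rw [alternating_four_sublist_append_iff nA, alternating_four_sublist_append_iff nB,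
    alternating_four_sublist_append_iff nC, alternating_four_sublist_append_iff nD,
    alternating_four_sublist_append_iff nE, alternating_three_sublist_append_iff nB,
    alternating_three_sublist_append_iff nC, alternating_three_sublist_append_iff nD,
    alternating_three_sublist_append_iff nE] at h
  have hF4 : ¬ [x, y, x, y] <+ F := not_sublist_of_duplicate (x := x) nF (by simp)
  have hF3 : ¬ [y, x, y] <+ F := not_sublist_of_duplicate (x := y) nF (by simp)
  simp only [pair_sublist_append_iff, List.mem_append, hF4, hF3, false_or] at h
  have pA : ∀ i j, [i, j] <+ A → i ∈ A ∧ j ∈ A := fun i j h => mem_of_pair_sublist h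
  have pB : ∀ i j, [i, j] <+ B → i ∈ B ∧ j ∈ B := fun i j h => mem_of_pair_sublist h
  have pC : ∀ i j, [i, j] <+ C → i ∈ C ∧ j ∈ C := fun i j h => mem_of_pair_sublist h
  have pD : ∀ i j, [i, j] <+ D → i ∈ D ∧ j ∈ D := fun i j h => mem_of_pair_sublist h
  have pE : ∀ i j, [i, j] <+ E → i ∈ E ∧ j ∈ E := fun i j h => mem_of_pair_sublist h
  have pF : ∀ i j, [i, j] <+ F → i ∈ F ∧ j ∈ F := fun i j h => mem_of_pair_sublist h
  rcases x with i | ⟨e, c, b⟩ <;> rcases y with j | ⟨e', c', b'⟩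
  · have q : ∀ i j, (¬ [Sum.inl i, Sum.inl j] <+ A) ∧ (¬ [Sum.inl i, Sum.inl j] <+ B) ∧
        (¬ [Sum.inl i, Sum.inl j] <+ D) ∧ (¬ [Sum.inl i, Sum.inl j] <+ E) :=
      fun i j => ⟨fun h => moA _ (pA _ _ h).1, fun h => moB _ (pB _ _ h).1,
        fun h => moD _ (pD _ _ h).1, fun h => moE _ (pE _ _ h).1⟩
    simp only [moA, moB, moD, moE, q, false_and, and_false, false_or, or_false] at h
    exact oo i j (fun hij => hxy (by rw [hij])) h.1 h.2
  · have := moA i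
    have := moB i
    have := moD i
    have := moE i
    have := mo i
    have := mr e' c' b'
    have := orC i e' c' b'
    have := orF i e' c' b'
    have := roC i e' c' b'
    have := roF i e' c' b'
    clear rA rB rC rD rE rF oo orC orF roC roF moA moB moD moE mo mr
    grind
  · have := moA j
    have := moB j
    have := moD j
    have := moE j
    have := mo j
    have := mr e c b
    have := orC j e c b
    have := orF j e c b
    have := roC j e c b
    have := roF j e c b
    clear rA rB rC rD rE rF oo orC orF roC roF moA moB moD moE mo mr
    grind
  · have hne : e.val = e'.val → c.val = c'.val → b = b' → False := by
      intro h1 h2 h3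
      exact hxy (by rw [Fin.ext h1, Fin.ext h2, h3])
    have := rA e c b e' c' b'
    have := rB e c b e' c' b'
    have := rC e c b e' c' b'
    have := rD e c b e' c' b'
    have := rE e c b e' c' b'
    have := rF e c b e' c' b'
    have := rA e' c' b' e c b
    have := rB e' c' b' e c b
    have := rC e' c' b' e c b
    have := rD e' c' b' e c b
    have := rE e' c' b' e c b
    have := rF e' c' b' e c b
    have := mr e c b
    have := mr e' c' b'
    clear rA rB rC rD rE rF oo orC orF roC roF moA moB moD moE mo mr
    grind

end IsRedCross

end LiftNoAlternation

end MLCMInstance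

namespace MLCMInstance

section LiftCount

variable {n ℓ : ℕ} {ι : Type} {M : MLCMInstance (Fin n) ι}
  {M' : MLCMInstance (Fin n ⊕ (Fin (n - 1) × Fin 4)) (ι ⊕ (Fin (n - 1) × Fin ℓ × Bool))}

theorem redSign_leaf (u : Fin n) (q : Fin (n - 1) × Fin 4) :
    redSign (Sum.inr q) (Sum.inl u) = -redSign (Sum.inl u) (Sum.inr q) := by
  obtain ⟨e, p⟩ := q
  by_cases h : p.val ≤ 1 <;> simp [redSign, h]

theorem redSign_path (e : Fin (n - 1)) :
    redSign (Sum.inl (rv e)) (Sum.inl (lv e)) = -redSign (Sum.inl (lv e)) (Sum.inl (rv e)) := by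
  simp [redSign]

theorem EdgeCross.usesEdge_right {V ι : Type} {M : MLCMInstance V ι} {lay : M.Layout} {i j : ι}
    {u v : V} (h : EdgeCross lay i j u v) : M.usesEdge j u v :=
  (lay.mem_iff _ _ _).1 (List.mem_of_pair_sublist h.2.1).2

theorem IsRedCross.redSign_swap (hr : IsRedCross M M') {e c b x y}
    (h : M'.usesEdge (Sum.inr (e, c, b)) x y) : redSign y x = -redSign x y := by
  rcases (hr.uses_red _ _ _ _ _).1 h with h | h | h <;>
    rcases Sym2.eq_iff.1 h with ⟨rfl, rfl⟩ | ⟨rfl, rfl⟩ <;>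
      simp only [redSign_path, redSign_leaf, neg_neg]

theorem sym2_inl_lv_rv_injective {β : Type} (e e' : Fin (n - 1))
    (h : s((Sum.inl (lv e) : Fin n ⊕ β), Sum.inl (rv e)) = s(Sum.inl (lv e'), Sum.inl (rv e'))) :
    e = e' := by
  refine sym2_lv_rv_injective ?_
  simpa [Sym2.eq_iff] using h

/-- Every layout of `M` meeting the periphery condition extends to a layout of `M'` in which the
red lines cause exactly the unavoidable crossings. -/
theorem IsRedCross.exists_lift [Fintype ι] (hr : IsRedCross M M') (hrot : M.IsHorizontalPath)
    {lo hi : ι → ℕ} (hM : M.IsSpan lo hi) {lay : M.Layout} (hlay : NoAlternation lay)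
    (hper : Periphery lay) :
    ∃ lay' : M'.Layout, NoAlternation lay' ∧
      M'.crossingCount lay' =
        M.crossingCount lay + ∑ e : Fin (n - 1), (ℓ ^ 2 + ∑ i, weight M ℓ e i) := by
  obtain ⟨g, lay', hgt, hgn, hoo, hor, hro, hrr⟩ := hr.exists_lift_order hper
  refine ⟨lay', hr.noAlternation_of_order hrot hM hlay hgn (fun u v i j => (hoo u v i j).1)
    (fun u v i e c b h => ((hor u v i e c b).1 h).2.2)
    (fun u v i e c b h => ((hro u v i e c b).1 h).2.2)
    (fun x y e c b e' c' b' h => ((hrr x y e c b e' c' b').1 h).2.2), ?_⟩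
  have hpath : ∀ i a b, M'.usesEdge (Sum.inl i) a b →
      ∃ e : Fin (n - 1), s(a, b) = s(Sum.inl (lv e), Sum.inl (rv e)) := by
    rintro i (a | a) (b | b) h
    · obtain ⟨e, ⟨rfl, rfl⟩ | ⟨rfl, rfl⟩⟩ := hM.exists_edge ((hr.uses_old _ _ _).1 h)
      · exact ⟨e, rfl⟩
      · exact ⟨e, Sym2.eq_swap⟩
    · exact absurd h (hr.not_uses_old _ _ _)
    · exact absurd h (hr.not_uses_old_left _ _ _)
    · exact absurd h (hr.not_uses_old _ _ _)
  have hopp : ∀ e c b e' c' b' x y,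
      EdgeCross lay' (Sum.inr (e, c, b)) (Sum.inr (e', c', b')) x y → b = true ∧ b' = false := by
    intro e c b e' c' b' x y h
    have h1 := ((hrr _ _ _ _ _ _ _ _).1 h.2.1).2.2
    have h2 := ((hrr _ _ _ _ _ _ _ _).1 h.2.2).2.2
    have hs := hr.redSign_swap (EdgeCross.usesEdge h)
    rcases h1 with h1 | ⟨-, h1⟩
    · exact h1
    · rcases h2 with h2 | ⟨-, h2⟩
      · exact h2
      · rw [hs] at h2
        linarith
  rw [crossingCount_eq_sum lay' (f := fun e : Fin (n - 1) => Sum.inl (lv e))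
      (g := fun e => Sum.inl (rv e)) sym2_inl_lv_rv_injective,
    crossingCount_eq_sum lay (f := lv) (g := rv) (fun e e' => sym2_lv_rv_injective),
    ← Finset.sum_add_distrib]
  · refine Finset.sum_congr rfl fun e _ => ?_
    have hspan : ∀ i, M.usesEdge i (lv e) (rv e) →
        ¬ (M.Terminal i (lv e) ∧ M.Terminal i (rv e)) := by
      intro i hi
      have := hM.add_two_le i
      have := hM.uses_lv_rv.1 hi
      simp only [hM.terminal_iff, val_lv, val_rv]
      omega
    have hL : ∀ i, M.usesEdge i (lv e) (rv e) → (M.Terminal i (lv e) ∧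
        (g (lv e) (rv e) i = 0 ∨ g (lv e) (rv e) i = 4)) ∨
        (¬ M.Terminal i (lv e) ∧ g (lv e) (rv e) i = 2) := fun i hi => by
      by_cases ht : M.Terminal i (lv e)
      · exact Or.inl ⟨ht, hgt _ _ _ hi ht⟩
      · exact Or.inr ⟨ht, hgn _ _ _ hi ht⟩
    have hR : ∀ i, M.usesEdge i (lv e) (rv e) → (M.Terminal i (rv e) ∧
        (g (rv e) (lv e) i = 0 ∨ g (rv e) (lv e) i = 4)) ∨
        (¬ M.Terminal i (rv e) ∧ g (rv e) (lv e) i = 2) := fun i hi => by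
      by_cases ht : M.Terminal i (rv e)
      · exact Or.inl ⟨ht, hgt _ _ _ (usesEdge_comm.1 hi) ht⟩
      · exact Or.inr ⟨ht, hgn _ _ _ (usesEdge_comm.1 hi) ht⟩
    have hRC : ∀ i c b, RedCrossing lay' e i (c, b) ↔ M.usesEdge i (lv e) (rv e) ∧
        if b then 1 < g (lv e) (rv e) i ∧ 1 < g (rv e) (lv e) i
        else g (lv e) (rv e) i < 3 ∧ g (rv e) (lv e) i < 3 := by
      intro i c b
      have h1 := hr.uses_red_path e c b
      have h2 := usesEdge_comm.1 h1
      cases b <;> simp only [RedCrossing, edgeCross_iff, hor, hro, h1, h2,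
        usesEdge_comm (u := rv e)] <;> simp only [if_true, if_false, Bool.false_eq_true] <;> tauto
    rw [← Nat.card_subtype_comp_eq (crossingPair_injective e)
      (p := fun q => EdgeCross lay' q.1 q.2 (Sum.inl (lv e)) (Sum.inl (rv e))),
      card_crossingPair]
    · congr 1
      · simp only [edgeCross_iff, hoo]
      · congr 1
        refine Finset.sum_congr rfl fun i _ => ?_
        unfold weight
        split_ifs with hi ht
        · have h1 := hL i hi
          have h2 := hR i hi
          have h3 := hspan i hi
          by_cases hb : g (lv e) (rv e) i = 4 ∨ g (rv e) (lv e) i = 4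
          · refine card_redCrossing_of_iff (b := true) ?_
            rintro ⟨c, _ | _⟩ <;> simp only [hRC] <;> simp <;> grind
          · refine card_redCrossing_of_iff (b := false) ?_
            rintro ⟨c, _ | _⟩ <;> simp only [hRC] <;> simp <;> grind
        · refine card_redCrossing_of_forall ?_
          have h1 := hL i hi
          have h2 := hR i hi
          rintro ⟨c, _ | _⟩ <;> simp only [hRC] <;> simp <;> grind
        · have : IsEmpty {q // RedCrossing lay' e i q} :=
            ⟨fun ⟨⟨c, b⟩, hq⟩ => hi ((hRC _ _ _).1 hq).1⟩
          exact Nat.card_of_isEmpty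
    · intro c c'
      have h1 := hr.uses_red_path e c true
      have h2 := hr.uses_red_path e c' false
      rw [edgeCross_iff, hrr, hrr]
      exact ⟨⟨h1, h2, Or.inl ⟨rfl, rfl⟩⟩, usesEdge_comm.1 h1, usesEdge_comm.1 h2,
        Or.inl ⟨rfl, rfl⟩⟩
    · rintro ⟨i | ⟨e₁, c, b⟩, j | ⟨e₂, c', b'⟩⟩ h
      · exact ⟨Sum.inl (i, j), rfl⟩
      · obtain rfl := hr.red_edge_unique (hr.uses_red_path e c' b') (EdgeCross.usesEdge_right h)
        have h1 := (hor _ _ _ _ _ _).1 h.2.1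
        have h2 := (hor _ _ _ _ _ _).1 h.2.2
        cases b'
        · exact ⟨Sum.inr (Sum.inr (i, c', false)), rfl⟩
        · have h3 := hL i h1.1
          have h4 := hR i h1.1
          have h5 := hspan i h1.1
          simp only [if_true] at h1 h2
          grind
      · obtain rfl := hr.red_edge_unique (hr.uses_red_path e c b) (EdgeCross.usesEdge h)
        have h1 := (hro _ _ _ _ _ _).1 h.2.1
        have h2 := (hro _ _ _ _ _ _).1 h.2.2
        cases b
        · have h3 := hL j h1.2.1
          have h4 := hR j h1.2.1
          have h5 := hspan j h1.2.1
          simp only [if_false, Bool.false_eq_true] at h1 h2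
          grind
        · exact ⟨Sum.inr (Sum.inr (j, c, true)), rfl⟩
      · obtain rfl := hr.red_edge_unique (hr.uses_red_path e c b) (EdgeCross.usesEdge h)
        obtain rfl := hr.red_edge_unique (hr.uses_red_path e c' b') (EdgeCross.usesEdge_right h)
        obtain ⟨rfl, rfl⟩ := hopp _ _ _ _ _ _ _ _ h
        exact ⟨Sum.inr (Sum.inl (c, c')), rfl⟩
  · intro i j u v h
    obtain ⟨e, ⟨rfl, rfl⟩ | ⟨rfl, rfl⟩⟩ := hM.exists_edge (EdgeCross.usesEdge h)
    · exact ⟨e, rfl⟩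
    · exact ⟨e, Sym2.eq_swap⟩
  · rintro (i | ⟨e, c, b⟩) (j | ⟨e', c', b'⟩) x y h
    · exact hpath i x y (EdgeCross.usesEdge h)
    · exact hpath i x y (EdgeCross.usesEdge h)
    · exact hpath j x y (EdgeCross.usesEdge_right h)
    · obtain rfl := hr.red_edge_unique (EdgeCross.usesEdge h) (EdgeCross.usesEdge_right h)
      obtain ⟨rfl, rfl⟩ := hopp _ _ _ _ _ _ _ _ h
      refine ⟨e, ?_⟩
      have h1 := (hr.uses_red _ _ _ _ _).1 (EdgeCross.usesEdge h)
      have h2 := (hr.uses_red _ _ _ _ _).1 (EdgeCross.usesEdge_right h)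
      rcases h1 with h1 | h1 | h1
      · exact h1
      · rw [h1] at h2
        simp [Fin.ext_iff] at h2
      · rw [h1] at h2
        simp [Fin.ext_iff] at h2

end LiftCount

end MLCMInstance

namespace MLCMInstance

section Restriction

variable {n ℓ : ℕ} {ι : Type} {M : MLCMInstance (Fin n) ι}
  {M' : MLCMInstance (Fin n ⊕ (Fin (n - 1) × Fin 4)) (ι ⊕ (Fin (n - 1) × Fin ℓ × Bool))}

open List

namespace IsRedCross

theorem mem_filterMap_ord (hr : IsRedCross M M') (lay : M'.Layout) (u v : Fin n) (i : ι) :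
    i ∈ (lay.ord (Sum.inl u) (Sum.inl v)).filterMap Sum.getLeft? ↔ M.usesEdge i u v := by
  simp [List.mem_filterMap, ← hr.uses_old, ← lay.mem_iff]

/-- The layout of the old lines on the path induced by a layout of all lines. -/
def restrict (hr : IsRedCross M M') (lay : M'.Layout) : M.Layout where
  ord u v := (lay.ord (Sum.inl u) (Sum.inl v)).filterMap Sum.getLeft?
  nodup u v := (lay.nodup _ _).filterMap (by
    rintro (a | a) (b | b) c <;> simp
    rintro rfl rfl
    rfl)
  mem_iff u v i := hr.mem_filterMap_ord lay u v i

theorem pair_sublist_restrict (hr : IsRedCross M M') (lay : M'.Layout) {u v : Fin n} {i j : ι} :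
    [i, j] <+ (hr.restrict lay).ord u v ↔
      [Sum.inl i, Sum.inl j] <+ lay.ord (Sum.inl u) (Sum.inl v) := by
  have key : ∀ {x y : ι}, [Sum.inl x, Sum.inl y] <+ lay.ord (Sum.inl u) (Sum.inl v) →
      [x, y] <+ (hr.restrict lay).ord u v := fun h => by
    have := h.filterMap Sum.getLeft?
    simpa [restrict] using this
  refine ⟨fun h => ?_, key⟩
  have hm : ∀ x ∈ (hr.restrict lay).ord u v, Sum.inl x ∈ lay.ord (Sum.inl u) (Sum.inl v) :=
    fun x hx => (lay.mem_iff _ _ _).2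
      ((hr.uses_old _ _ _).2 (((hr.restrict lay).mem_iff _ _ _).1 hx))
  obtain ⟨h1, h2⟩ := mem_of_pair_sublist h
  have hne := ((hr.restrict lay).nodup u v).pair_sublist_ne h
  exact (pair_sublist_total (hm _ h1) (hm _ h2) (by simpa using hne)).resolve_right
    fun h' => ((hr.restrict lay).nodup u v).pair_sublist_asymm h (key h')

theorem edgeCross_restrict (hr : IsRedCross M M') (lay : M'.Layout) {u v : Fin n} {i j : ι} :
    EdgeCross (hr.restrict lay) i j u v ↔
      EdgeCross lay (Sum.inl i) (Sum.inl j) (Sum.inl u) (Sum.inl v) := by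
  simp only [edgeCross_iff, hr.pair_sublist_restrict]

variable {lay : M'.Layout}

theorem noAlternation_restrict (hr : IsRedCross M M') (hM : M.IsHorizontalPath)
    (hlay : NoAlternation lay) : NoAlternation (hr.restrict lay) := by
  rw [hM.noAlternation_iff]
  rintro e e' he i j hij ⟨h1, h2⟩
  rw [hr.pair_sublist_restrict] at h1 h2
  refine hlay (Sum.inl (lv e)) (Sum.inl i) (Sum.inl j) (by simpa using hij) ?_
  rw [hr.cyclicAt_inl]
  have her : edgeRight (lv e) = some e := edgeRight_eq_some.2 rfl
  have hel : edgeLeft (lv e) = some e' := edgeLeft_eq_some.2 (by simp [he])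
  exact (nil_sublist _).append ((nil_sublist _).append
    ((pair_sublist_slot.2 ⟨e, her, h1⟩).append ((nil_sublist _).append
      ((nil_sublist _).append (pair_sublist_slot.2 ⟨e', hel, h2⟩)))))

variable {lo hi : ι → ℕ}

theorem between_left (hr : IsRedCross M M') (hM : M.IsSpan lo hi) (hlay : NoAlternation lay)
    {e : Fin (n - 1)} {i : ι} (hi : M.usesEdge i (lv e) (rv e)) (ht : ¬ M.Terminal i (lv e))
    (c : Fin ℓ) :
    [Sum.inr (e, c, true), Sum.inl i] <+ lay.ord (Sum.inl (lv e)) (Sum.inl (rv e)) ∧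
    [Sum.inl i, Sum.inr (e, c, false)] <+ lay.ord (Sum.inl (lv e)) (Sum.inl (rv e)) := by
  have h := hM.uses_lv_rv.1 hi
  rw [hM.terminal_iff, val_lv] at ht
  have := e.isLt
  refine hr.old_left hlay (e' := ⟨e.val - 1, by omega⟩) (Fin.ext ?_) hi (hM.uses_lv_rv.2 ?_) c
  · simp only [val_rv, val_lv]
    omega
  · simp only
    omega

theorem between_right (hr : IsRedCross M M') (hM : M.IsSpan lo hi) (hlay : NoAlternation lay)
    {e : Fin (n - 1)} {i : ι} (hi : M.usesEdge i (lv e) (rv e)) (ht : ¬ M.Terminal i (rv e))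
    (c : Fin ℓ) :
    [Sum.inr (e, c, true), Sum.inl i] <+ lay.ord (Sum.inl (rv e)) (Sum.inl (lv e)) ∧
    [Sum.inl i, Sum.inr (e, c, false)] <+ lay.ord (Sum.inl (rv e)) (Sum.inl (lv e)) := by
  have h := hM.uses_lv_rv.1 hi
  rw [hM.terminal_iff, val_rv] at ht
  have := hM.lt i
  refine hr.old_right hlay (e' := ⟨e.val + 1, by omega⟩) (Fin.ext ?_) hi (hM.uses_lv_rv.2 ?_) c
  · simp
  · simp only
    omega

/-- A line lying between the red lines of `e` at both ports of `e` crosses all of them. -/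
theorem redCrossing_of_between {e : Fin (n - 1)} {i : ι}
    (hl : ∀ c : Fin ℓ,
      [Sum.inr (e, c, true), Sum.inl i] <+ lay.ord (Sum.inl (lv e)) (Sum.inl (rv e)) ∧
      [Sum.inl i, Sum.inr (e, c, false)] <+ lay.ord (Sum.inl (lv e)) (Sum.inl (rv e)))
    (hr : ∀ c : Fin ℓ,
      [Sum.inr (e, c, true), Sum.inl i] <+ lay.ord (Sum.inl (rv e)) (Sum.inl (lv e)) ∧
      [Sum.inl i, Sum.inr (e, c, false)] <+ lay.ord (Sum.inl (rv e)) (Sum.inl (lv e)))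
    (q : Fin ℓ × Bool) : RedCrossing lay e i q := by
  obtain ⟨c, b⟩ := q
  cases b
  · simpa [RedCrossing, edgeCross_iff] using ⟨(hl c).2, (hr c).2⟩
  · simpa [RedCrossing, edgeCross_iff] using ⟨(hl c).1, (hr c).1⟩

theorem above_or_below {u v : Fin n} {e : Fin (n - 1)} {i : ι} {c : Fin ℓ}
    (hi : Sum.inl i ∈ lay.ord (Sum.inl u) (Sum.inl v))
    (h : [Sum.inr (e, c, true), Sum.inr (e, c, false)] <+ lay.ord (Sum.inl u) (Sum.inl v)) :
    [Sum.inr (e, c, true), Sum.inl i] <+ lay.ord (Sum.inl u) (Sum.inl v) ∨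
    [Sum.inl i, Sum.inr (e, c, false)] <+ lay.ord (Sum.inl u) (Sum.inl v) := by
  refine (pair_sublist_total (mem_of_pair_sublist h).1 hi (by simp)).imp_right fun h' => ?_
  exact (lay.nodup _ _).pair_sublist_trans h' h

theorem weight_le (hr : IsRedCross M M') (hM : M.IsSpan lo hi) (hlay : NoAlternation lay)
    (e : Fin (n - 1)) (i : ι) : weight M ℓ e i ≤ Nat.card {q // RedCrossing lay e i q} := by
  unfold weight
  split_ifs with hu ht
  · have hL := fun c => above_or_below
      ((lay.mem_iff _ _ _).2 ((hr.uses_old _ _ _).2 hu)) (hr.red_left hlay e c c)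
    have hR := fun c => above_or_below
      ((lay.mem_iff _ _ _).2 ((hr.uses_old _ _ _).2 (usesEdge_comm.1 hu)))
      (hr.red_right hlay e c c)
    refine le_card_redCrossing fun c => ?_
    simp only [RedCrossing, edgeCross_iff, if_true, Bool.false_eq_true, if_false]
    by_cases h1 : M.Terminal i (lv e)
    · have h2 : ¬ M.Terminal i (rv e) := by
        have := hM.add_two_le i
        have := hM.uses_lv_rv.1 hu
        simp only [hM.terminal_iff, val_lv, val_rv] at h1 ⊢
        omega
      have h3 := hr.between_right hM hlay hu h2 c
      exact (hL c).imp (⟨·, h3.1⟩) (⟨·, h3.2⟩)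
    · have h3 := hr.between_left hM hlay hu h1 c
      exact (hR c).imp (⟨h3.1, ·⟩) (⟨h3.2, ·⟩)
  · rw [not_or] at ht
    exact (card_redCrossing_of_forall (redCrossing_of_between
      (hr.between_left hM hlay hu ht.1) (hr.between_right hM hlay hu ht.2))).ge
  · exact Nat.zero_le _

theorem sum_crossings_le [Fintype ι] (hr : IsRedCross M M') (hM : M.IsSpan lo hi)
    (hlay : NoAlternation lay) :
    M.crossingCount (hr.restrict lay) +
      ∑ e : Fin (n - 1), (ℓ ^ 2 + ∑ i, Nat.card {q // RedCrossing lay e i q}) ≤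
    M'.crossingCount lay := by
  rw [crossingCount_eq_sum (hr.restrict lay) (f := lv) (g := rv)
    (fun e e' => sym2_lv_rv_injective), ← Finset.sum_add_distrib]
  · refine le_trans (Finset.sum_le_sum fun e _ => ?_) (sum_card_edgeCross_le lay
      (f := fun e => Sum.inl (lv e)) (g := fun e => Sum.inl (rv e)) sym2_inl_lv_rv_injective)
    refine le_trans (le_of_eq ?_) (Nat.card_subtype_comp_le (crossingPair_injective e)
      (fun q => EdgeCross lay q.1 q.2 (Sum.inl (lv e)) (Sum.inl (rv e))))
    rw [card_crossingPair
      fun c c' => edgeCross_iff.2 ⟨hr.red_left hlay e c c', hr.red_right hlay e c c'⟩]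
    simp only [hr.edgeCross_restrict]
  · intro i j u v h
    obtain ⟨e, ⟨rfl, rfl⟩ | ⟨rfl, rfl⟩⟩ := hM.exists_edge (EdgeCross.usesEdge h)
    · exact ⟨e, rfl⟩
    · exact ⟨e, Sym2.eq_swap⟩

/-- Unless some line with a terminal on `e` crosses all red lines of `e`, the restriction satisfies
the periphery condition. -/
theorem periphery_restrict (hr : IsRedCross M M') (hM : M.IsSpan lo hi) (hlay : NoAlternation lay)
    (h : ∀ e i, M.usesEdge i (lv e) (rv e) → M.Terminal i (lv e) ∨ M.Terminal i (rv e) →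
      ¬ ∀ q, RedCrossing lay e i q) : Periphery (hr.restrict lay) := by
  intro u v
  refine exists_periphery_split (fun i => M.Terminal i u) ?_
  intro a b c habc ha hb
  by_contra hc
  have hab : [a, b] <+ (hr.restrict lay).ord u v := Sublist.trans (by simp) habc
  have hbc : [b, c] <+ (hr.restrict lay).ord u v := Sublist.trans (by simp) habc
  have hua := ((hr.restrict lay).mem_iff _ _ _).1 (mem_of_pair_sublist hab).1
  have hub := ((hr.restrict lay).mem_iff _ _ _).1 (mem_of_pair_sublist hab).2
  have huc := ((hr.restrict lay).mem_iff _ _ _).1 (mem_of_pair_sublist hbc).2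
  rw [hr.pair_sublist_restrict] at hab hbc
  have hlen := hM.add_two_le b
  obtain ⟨e, ⟨rfl, rfl⟩ | ⟨rfl, rfl⟩⟩ := hM.exists_edge hub
  · refine h e b hub (Or.inl hb) (redCrossing_of_between (fun d => ?_)
      (hr.between_right hM hlay hub ?_))
    · exact ⟨(lay.nodup _ _).pair_sublist_trans (hr.between_left hM hlay hua ha d).1 hab,
        (lay.nodup _ _).pair_sublist_trans hbc (hr.between_left hM hlay huc hc d).2⟩
    · have := hM.uses_lv_rv.1 hub
      simp only [hM.terminal_iff, val_lv, val_rv] at hb ⊢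
      omega
  · rw [usesEdge_comm] at hua hub huc
    refine h e b hub (Or.inr hb) (redCrossing_of_between
      (hr.between_left hM hlay hub ?_) fun d => ?_)
    · have := hM.uses_lv_rv.1 hub
      simp only [hM.terminal_iff, val_lv, val_rv] at hb ⊢
      omega
    · exact ⟨(lay.nodup _ _).pair_sublist_trans (hr.between_right hM hlay hua ha d).1 hab,
        (lay.nodup _ _).pair_sublist_trans hbc (hr.between_right hM hlay huc hc d).2⟩

theorem add_le_sum_card_redCrossing [Fintype ι] (hr : IsRedCross M M') (hM : M.IsSpan lo hi)
    (hlay : NoAlternation lay) {e₀ : Fin (n - 1)} {i₀ : ι}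
    (ht : M.Terminal i₀ (lv e₀) ∨ M.Terminal i₀ (rv e₀)) (hall : ∀ q, RedCrossing lay e₀ i₀ q) :
    ℓ + ∑ e : Fin (n - 1), (ℓ ^ 2 + ∑ i, weight M ℓ e i) ≤
      ∑ e : Fin (n - 1), (ℓ ^ 2 + ∑ i, Nat.card {q // RedCrossing lay e i q}) := by
  classical
  have hle : ∀ e i, weight M ℓ e i + (if e = e₀ ∧ i = i₀ then ℓ else 0) ≤
      Nat.card {q // RedCrossing lay e i q} := by
    intro e i
    split_ifs with h
    · obtain ⟨rfl, rfl⟩ := h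
      rw [card_redCrossing_of_forall hall, weight]
      split_ifs <;> omega
    · exact hr.weight_le hM hlay e i
  have hsum : ∑ e : Fin (n - 1), ∑ i, (if e = e₀ ∧ i = i₀ then ℓ else 0) = ℓ := by
    rw [Finset.sum_eq_single e₀ (fun e _ he => by simp [he]) (by simp)]
    simp
  have := Finset.sum_le_sum fun e (_ : e ∈ Finset.univ) =>
    Finset.sum_le_sum fun i (_ : i ∈ Finset.univ) => hle e i
  simp only [Finset.sum_add_distrib] at this ⊢
  omega

/-- A layout of the red cross instance yields a solution of the path instance. -/
theorem exists_periphery_layout [Fintype ι] (hr : IsRedCross M M') (hrot : M.IsHorizontalPath)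
    (hM : M.IsSpan lo hi) (hℓ : Nat.card ι ^ 2 ≤ ℓ) (hlay : NoAlternation lay) :
    ∃ lay₁ : M.Layout, NoAlternation lay₁ ∧ Periphery lay₁ ∧
      M.crossingCount lay₁ + ∑ e : Fin (n - 1), (ℓ ^ 2 + ∑ i, weight M ℓ e i) ≤
        M'.crossingCount lay := by
  have hsum := hr.sum_crossings_le hM hlay
  by_cases h : ∃ e i, M.usesEdge i (lv e) (rv e) ∧
      (M.Terminal i (lv e) ∨ M.Terminal i (rv e)) ∧ ∀ q, RedCrossing lay e i q
  · obtain ⟨e, i, -, ht, hall⟩ := h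
    obtain ⟨lay₁, h1, h2, h3⟩ := hM.exists_few_crossings hrot
    have := hr.add_le_sum_card_redCrossing hM hlay ht hall
    exact ⟨lay₁, h1, h2, by omega⟩
  · push Not at h
    refine ⟨hr.restrict lay, hr.noAlternation_restrict hrot hlay,
      hr.periphery_restrict hM hlay fun e i hu ht hall => ?_, le_trans ?_ hsum⟩
    · obtain ⟨q, hq⟩ := h e i hu ht
      exact hq (hall q)
    · exact Nat.add_le_add_left (Finset.sum_le_sum fun e _ =>
        Nat.add_le_add_left (Finset.sum_le_sum fun i _ => hr.weight_le hM hlay e i) _) _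

end IsRedCross

end Restriction

end MLCMInstance

open MLCMInstance in
/-- The reduction from MLCM-P on a path to MLCM on a
caterpillar: `(G, L)` has an MLCM-P solution with at most `k` crossings iff
the reduced instance `(G', L')` (with a red cross of `2ℓ = 2|L|²` red lines
added to every edge of the path) has an MLCM solution with at most `k + K`
crossings, where `K = |E|ℓ² + ∑ₑ (ℓₑᵗ + 2ℓₑᵐ)ℓ`. -/
theorem mlcmp_path_reduces_to_mlcm_caterpillar
    {n : ℕ} {ι : Type} [Fintype ι] (hn : 2 ≤ n)
    -- the original instance: an MLCM-P instance on a path with `n` vertices,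
    -- embedded along a horizontal line
    (M : MLCMInstance (Fin n) ι)
    (hMadj : ∀ a b : Fin n, M.G.adj a b ↔ (a.val + 1 = b.val ∨ b.val + 1 = a.val))
    (hMrot0 : M.G.rot ⟨0, by omega⟩ = [⟨1, by omega⟩])
    (hMrotLast : M.G.rot ⟨n - 1, by omega⟩ = [⟨n - 2, by omega⟩])
    (hMrotInt : ∀ (u : ℕ) (h1 : 0 < u) (h2 : u < n - 1),
      M.G.rot ⟨u, by omega⟩ = [⟨u + 1, by omega⟩, ⟨u - 1, by omega⟩])
    -- no line of `L` lies entirely on a single edge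
    (hlong : ∀ i : ι, 3 ≤ (M.line i).length)
    -- the reduced MLCM instance `(G', L')`: to each edge `e = (u, v)` of the
    -- path a red cross is added, with vertices `u₁ = (e,0)`, `u₂ = (e,1)`,
    -- `v₁ = (e,2)`, `v₂ = (e,3)` (`u₁, v₁` above and `u₂, v₂` below the
    -- path), and `ℓ = |L|²` red lines from `u₁` to `v₂` (`true`) as well as
    -- `ℓ` red lines from `u₂` to `v₁` (`false`)
    (M' : MLCMInstance (Fin n ⊕ (Fin (n - 1) × Fin 4))
      (ι ⊕ (Fin (n - 1) × Fin (Nat.card ι ^ 2) × Bool)))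
    (hold : ∀ i : ι, M'.line (Sum.inl i) = (M.line i).map Sum.inl)
    (hredT : ∀ (e : Fin (n - 1)) (c : Fin (Nat.card ι ^ 2)),
      M'.line (Sum.inr (e, c, true)) =
        [Sum.inr (e, 0), Sum.inl ⟨e.val, by have := e.isLt; omega⟩,
         Sum.inl ⟨e.val + 1, by have := e.isLt; omega⟩, Sum.inr (e, 3)])
    (hredF : ∀ (e : Fin (n - 1)) (c : Fin (Nat.card ι ^ 2)),
      M'.line (Sum.inr (e, c, false)) =
        [Sum.inr (e, 1), Sum.inl ⟨e.val, by have := e.isLt; omega⟩,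
         Sum.inl ⟨e.val + 1, by have := e.isLt; omega⟩, Sum.inr (e, 2)])
    (hadj' : ∀ a b : Fin n ⊕ (Fin (n - 1) × Fin 4), M'.G.adj a b ↔
      ((∃ u v : Fin n, a = Sum.inl u ∧ b = Sum.inl v ∧
          (u.val + 1 = v.val ∨ v.val + 1 = u.val)) ∨
       (∃ (u : Fin n) (e : Fin (n - 1)) (p : Fin 4),
          ((a = Sum.inl u ∧ b = Sum.inr (e, p)) ∨
           (a = Sum.inr (e, p) ∧ b = Sum.inl u)) ∧
          ((u.val = e.val ∧ (p = 0 ∨ p = 1)) ∨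
           (u.val = e.val + 1 ∧ (p = 2 ∨ p = 3))))))
    -- the embedding of `G'`: clockwise rotations at the path vertices ...
    (hrot'0 : M'.G.rot (Sum.inl ⟨0, by omega⟩) =
      [Sum.inr (⟨0, by omega⟩, 0), Sum.inl ⟨1, by omega⟩, Sum.inr (⟨0, by omega⟩, 1)])
    (hrot'Last : M'.G.rot (Sum.inl ⟨n - 1, by omega⟩) =
      [Sum.inr (⟨n - 2, by omega⟩, 2), Sum.inr (⟨n - 2, by omega⟩, 3),
       Sum.inl ⟨n - 2, by omega⟩])
    (hrot'Int : ∀ (u : ℕ) (h1 : 0 < u) (h2 : u < n - 1),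
      M'.G.rot (Sum.inl ⟨u, by omega⟩) =
        [Sum.inr (⟨u - 1, by omega⟩, 2), Sum.inr (⟨u, by omega⟩, 0),
         Sum.inl ⟨u + 1, by omega⟩, Sum.inr (⟨u, by omega⟩, 1),
         Sum.inr (⟨u - 1, by omega⟩, 3), Sum.inl ⟨u - 1, by omega⟩])
    -- ... and at the leaf vertices of the red crosses
    (hrot'Leaf : ∀ (e : Fin (n - 1)) (p : Fin 4),
      M'.G.rot (Sum.inr (e, p)) =
        [Sum.inl (if p.val ≤ 1 then ⟨e.val, by have := e.isLt; omega⟩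
                  else ⟨e.val + 1, by have := e.isLt; omega⟩)])
    (k : ℕ) :
    (∃ lay : M.Layout, Feasible lay ∧ Periphery lay ∧
        M.crossingCount lay ≤ k) ↔
    (∃ lay' : M'.Layout, Feasible lay' ∧
        M'.crossingCount lay' ≤ k + M.Kconst) := by
  obtain ⟨lo, hi, hM⟩ := exists_isSpan M hMadj hlong
  have hrot := isHorizontalPath_of_rot hn (fun _ _ => hMrot0)
    (fun _ _ => hMrotLast) fun u h1 h2 _ _ _ => hMrotInt u h1 h2
  have hr : IsRedCross M M' := isRedCross_of_lines hn hold hredT hredF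
    (fun _ _ _ => hrot'0) (fun _ _ _ => hrot'Last) (fun u h1 h2 _ _ _ _ => hrot'Int u h1 h2)
    fun e p => ⟨_, hrot'Leaf e p⟩
  obtain ⟨lay₀, h₀, hper₀, -⟩ := hM.exists_few_crossings hrot
  obtain ⟨lay₀', h₀', -⟩ := hr.exists_lift hrot hM h₀ hper₀
  rw [Kconst_eq]
  constructor
  · rintro ⟨lay, hfeas, hper, hk⟩
    obtain ⟨lay', hlay', hcount⟩ := hr.exists_lift hrot hM (hfeas.noAlternation h₀) hper
    exact ⟨lay', hlay'.feasible, hcount.le.trans (Nat.add_le_add_right hk _)⟩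
  · rintro ⟨lay', hfeas, hk⟩
    obtain ⟨lay, hlay, hper, hcount⟩ :=
      hr.exists_periphery_layout hrot hM le_rfl (hfeas.noAlternation h₀')
    exact ⟨lay, hlay.feasible, hper, Nat.le_of_add_le_add_right (hcount.trans hk)⟩
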